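/- arXiv:0803.3005 — 7 statements merged into one kernel-verified Lean document; each statement's English description precedes it below -/
import Mathlib

section
/- Let G₆ be the group presented by six generators γ₁, γ₁', γ₂, γ₂', γ₃, γ₃' subject to the relations: γ₂ = γ₂'; ⟨γ₁,γ₂'⟩ = ⟨γ₁',γ₂'⟩ = ⟨γ₁'γ₁γ₁'⁻¹, γ₂'⟩ = e; ⟨γ₂'γ₂γ₂'⁻¹, γ₃⟩ = ⟨γ₂'γ₂γ₂'⁻¹, γ₃'⟩ = ⟨γ₂'γ₂γ₂'⁻¹, γ₃'γ₃γ₃'⁻¹⟩ = e; γ₁⁻¹γ₁'⁻¹γ₂'⁻¹γ₃'γ₃γ₂'γ₂γ₂'⁻¹γ₃⁻¹γ₃'⁻¹γ₂'γ₁'γ₁ = γ₂'; [γ₁, γ₂'⁻¹γ₃γ₂'] = [γ₁', γ₂'⁻¹γ₃⁻¹γ₃'γ₃γ₂'] = e; [γ₁, γ₂'⁻¹γ₃γ₂'] = [γ₁, γ₂'⁻¹γ₃⁻¹γ₃'γ₃γ₂'] = e; γ₁ = γ₁'; γ₃ = γ₃'. Let G₃ be the group presented by three generators γ₁, γ₂,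 γ₃ subject to the relations ⟨γ₁,γ₂⟩ = e, ⟨γ₂,γ₃⟩ = e, [γ₂, γ₁²γ₃²] = e, [γ₁, γ₂⁻¹γ₃γ₂] = e. Then there is a group isomorphism G₆ ≅ G₃ sending γ₁ ↦ γ₁, γ₁' ↦ γ₁, γ₂ ↦ γ₂, γ₂' ↦ γ₂, γ₃ ↦ γ₃, γ₃' ↦ γ₃. -/
/-- The triple commutator `⟨x,y⟩ = x y x y⁻¹ x⁻¹ y⁻¹` (so `⟨x,y⟩ = e` iff `xyx = yxy`). -/
def tripleComm {G : Type*} [Group G] (x y : G) : G := x * y * x * y⁻¹ * x⁻¹ * y⁻¹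

/-- The commutator `[x,y] = x y x⁻¹ y⁻¹`. -/
def simpleComm {G : Type*} [Group G] (x y : G) : G := x * y * x⁻¹ * y⁻¹

namespace CayleySix

/-- Generators of the free group on six letters, indexed so that
`0 ↦ γ₁`, `1 ↦ γ₁'`, `2 ↦ γ₂`, `3 ↦ γ₂'`, `4 ↦ γ₃`, `5 ↦ γ₃'`. -/
def g : Fin 6 → FreeGroup (Fin 6) := FreeGroup.of

/-- The relators of the six-generator presentation (relations (7)–(14) of the paper):
`γ₂ = γ₂'`; `⟨γ₁,γ₂'⟩ = ⟨γ₁',γ₂'⟩ = ⟨γ₁'γ₁γ₁'⁻¹,γ₂'⟩ = e`;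
`⟨γ₂'γ₂γ₂'⁻¹,γ₃⟩ = ⟨γ₂'γ₂γ₂'⁻¹,γ₃'⟩ = ⟨γ₂'γ₂γ₂'⁻¹,γ₃'γ₃γ₃'⁻¹⟩ = e`;
`γ₁⁻¹γ₁'⁻¹γ₂'⁻¹γ₃'γ₃γ₂'γ₂γ₂'⁻¹γ₃⁻¹γ₃'⁻¹γ₂'γ₁'γ₁ = γ₂'`;
`[γ₁,γ₂'⁻¹γ₃γ₂'] = [γ₁',γ₂'⁻¹γ₃⁻¹γ₃'γ₃γ₂'] = e`;
`[γ₁,γ₂'⁻¹γ₃γ₂'] = [γ₁,γ₂'⁻¹γ₃⁻¹γ₃'γ₃γ₂'] = e`; `γ₁ = γ₁'`; `γ₃ = γ₃'`. -/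
def rels : Set (FreeGroup (Fin 6)) :=
  { g 2 * (g 3)⁻¹,
    tripleComm (g 0) (g 3),
    tripleComm (g 1) (g 3),
    tripleComm (g 1 * g 0 * (g 1)⁻¹) (g 3),
    tripleComm (g 3 * g 2 * (g 3)⁻¹) (g 4),
    tripleComm (g 3 * g 2 * (g 3)⁻¹) (g 5),
    tripleComm (g 3 * g 2 * (g 3)⁻¹) (g 5 * g 4 * (g 5)⁻¹),
    ((g 0)⁻¹ * (g 1)⁻¹ * (g 3)⁻¹ * g 5 * g 4 * g 3 * g 2 * (g 3)⁻¹ * (g 4)⁻¹ * (g 5)⁻¹ *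
        g 3 * g 1 * g 0) * (g 3)⁻¹,
    simpleComm (g 0) ((g 3)⁻¹ * g 4 * g 3),
    simpleComm (g 1) ((g 3)⁻¹ * (g 4)⁻¹ * g 5 * g 4 * g 3),
    simpleComm (g 0) ((g 3)⁻¹ * (g 4)⁻¹ * g 5 * g 4 * g 3),
    g 0 * (g 1)⁻¹,
    g 4 * (g 5)⁻¹ }

end CayleySix

namespace CayleyThree

/-- Generators of the free group on three letters, indexed so that
`0 ↦ γ₁`, `1 ↦ γ₂`, `2 ↦ γ₃`. -/
def g : Fin 3 → FreeGroup (Fin 3) := FreeGroup.of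

/-- The relators of the three-generator presentation:
`⟨γ₁,γ₂⟩ = e`, `⟨γ₂,γ₃⟩ = e`, `[γ₂,γ₁²γ₃²] = e`, `[γ₁,γ₂⁻¹γ₃γ₂] = e`. -/
def rels : Set (FreeGroup (Fin 3)) :=
  { tripleComm (g 0) (g 1),
    tripleComm (g 1) (g 2),
    simpleComm (g 1) ((g 0) ^ 2 * (g 2) ^ 2),
    simpleComm (g 0) ((g 1)⁻¹ * g 2 * g 1) }

end CayleyThree

theorem map_tripleComm {G H : Type*} [Group G] [Group H] (f : G →* H) (x y : G) :
    f (tripleComm x y) = tripleComm (f x) (f y) := by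
  simp [tripleComm]

theorem map_simpleComm {G H : Type*} [Group G] [Group H] (f : G →* H) (x y : G) :
    f (simpleComm x y) = simpleComm (f x) (f y) := by
  simp [simpleComm]

theorem tripleComm_eq_one_iff {G : Type*} [Group G] {x y : G} :
    tripleComm x y = 1 ↔ x * y * x = y * x * y := by
  rw [tripleComm, mul_inv_eq_one, mul_inv_eq_iff_eq_mul, mul_inv_eq_iff_eq_mul]

theorem simpleComm_eq_one_iff {G : Type*} [Group G] {x y : G} :
    simpleComm x y = 1 ↔ x * y = y * x := by
  rw [simpleComm, mul_inv_eq_one, mul_inv_eq_iff_eq_mul]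

/-- If `x` and `y` satisfy the braid relation, then conjugating `y` by `y * x ^ 2` is the same as
conjugating it by `x⁻¹ ^ 2`. -/
theorem conj_mul_sq_of_tripleComm_eq_one {G : Type*} [Group G] {x y : G}
    (h : tripleComm x y = 1) :
    y * x * x * y * x⁻¹ * x⁻¹ * y⁻¹ = x⁻¹ * x⁻¹ * y * x * x := by
  rw [tripleComm_eq_one_iff] at h
  have h₁ : x * y * x⁻¹ = y⁻¹ * x * y := by
    rw [mul_inv_eq_iff_eq_mul, mul_assoc, mul_assoc, eq_inv_mul_iff_mul_eq]
    simpa only [mul_assoc] using h.symm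
  have h₂ : y * x * y⁻¹ = x⁻¹ * y * x := by
    rw [mul_inv_eq_iff_eq_mul, mul_assoc, mul_assoc, eq_inv_mul_iff_mul_eq]
    simpa only [mul_assoc] using h
  calc y * x * x * y * x⁻¹ * x⁻¹ * y⁻¹ = y * x * (x * y * x⁻¹) * x⁻¹ * y⁻¹ := by group
    _ = y * x * (y⁻¹ * x * y) * x⁻¹ * y⁻¹ := by rw [h₁]
    _ = (y * x * y⁻¹) * (x * y * x⁻¹) * y⁻¹ := by group
    _ = (x⁻¹ * y * x) * (y⁻¹ * x * y) * y⁻¹ := by rw [h₁, h₂]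
    _ = x⁻¹ * (y * x * y⁻¹) * x := by group
    _ = x⁻¹ * x⁻¹ * y * x * x := by rw [h₂]; simp only [mul_assoc]

/-- Given the braid relation between `x` and `y`, the long relator of the six-generator
presentation is trivial exactly when `y` commutes with `x ^ 2 * z ^ 2`. -/
theorem long_relator_eq_one_iff {G : Type*} [Group G] {x y z : G} (h : tripleComm x y = 1) :
    x⁻¹ * x⁻¹ * y⁻¹ * z * z * y * y * y⁻¹ * z⁻¹ * z⁻¹ * y * x * x * y⁻¹ = 1 ↔
      simpleComm y (x ^ 2 * z ^ 2) = 1 := by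
  have hc := conj_mul_sq_of_tripleComm_eq_one h
  have hl : x⁻¹ * x⁻¹ * y⁻¹ * z * z * y * y * y⁻¹ * z⁻¹ * z⁻¹ * y * x * x * y⁻¹ =
      (y * x * x)⁻¹ * ((z * z * y * z⁻¹ * z⁻¹) * (y * x * x * y * x⁻¹ * x⁻¹ * y⁻¹)⁻¹) *
        (y * x * x) := by simp [mul_assoc]
  have hr : simpleComm y (x ^ 2 * z ^ 2) =
      (x * x) * ((z * z * y * z⁻¹ * z⁻¹) * (x⁻¹ * x⁻¹ * y * x * x)⁻¹)⁻¹ * (x * x)⁻¹ := by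
    simp [simpleComm, pow_two, mul_assoc]
  rw [hl, hr, hc, conj_eq_one_iff, inv_eq_one]
  simpa using conj_eq_one_iff (a := (y * x * x)⁻¹)
    (b := z * z * y * z⁻¹ * z⁻¹ * (x⁻¹ * x⁻¹ * y * x * x)⁻¹)

/-- Images of the generators of the six-generator group. -/
def sixToThree : Fin 6 → PresentedGroup CayleyThree.rels :=
  ![.of 0, .of 0, .of 1, .of 1, .of 2, .of 2]

/-- Images of the generators of the three-generator group. -/
def threeToSix : Fin 3 → PresentedGroup CayleySix.rels :=
  ![.of 0, .of 2, .of 4]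

theorem lift_sixToThree_eq_one :
    ∀ r ∈ CayleySix.rels, FreeGroup.lift sixToThree r = 1 := by
  have rel {r} (hr : r ∈ CayleyThree.rels) :
      PresentedGroup.mk CayleyThree.rels r = 1 := PresentedGroup.one_of_mem hr
  have h₁ := rel (.inl rfl)
  have h₂ := rel (.inr (.inl rfl))
  have h₃ := rel (.inr (.inr (.inl rfl)))
  have h₄ := rel (.inr (.inr (.inr rfl)))
  have hg (i) : PresentedGroup.mk CayleyThree.rels (CayleyThree.g i) = .of i := rfl
  simp only [map_tripleComm, map_simpleComm, map_mul, map_inv, map_pow, hg] at h₁ h₂ h₃ h₄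
  have hlong := (long_relator_eq_one_iff h₁).2 h₃
  simp only [CayleySix.rels, Set.mem_insert_iff, Set.mem_singleton_iff]
  rintro r (rfl | rfl | rfl | rfl | rfl | rfl | rfl | rfl | rfl | rfl | rfl | rfl | rfl) <;>
    simp only [map_tripleComm, map_simpleComm, map_mul, map_inv, CayleySix.g,
      FreeGroup.lift_apply_of]
  exacts [mul_inv_cancel _, h₁, h₁, by simpa [sixToThree] using h₁, by simpa [sixToThree] using h₂,
    by simpa [sixToThree] using h₂, by simpa [sixToThree] using h₂, hlong, h₄,
    by simpa [sixToThree] using h₄, by simpa [sixToThree] using h₄, mul_inv_cancel _,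
    mul_inv_cancel _]

theorem of_eq_of_six :
    (PresentedGroup.of 1 : PresentedGroup CayleySix.rels) = .of 0 ∧
      (PresentedGroup.of 3 : PresentedGroup CayleySix.rels) = .of 2 ∧
      (PresentedGroup.of 5 : PresentedGroup CayleySix.rels) = .of 4 :=
  ⟨(PresentedGroup.mk_eq_mk_of_mul_inv_mem (by simp [CayleySix.rels, CayleySix.g])).symm,
    (PresentedGroup.mk_eq_mk_of_mul_inv_mem (by simp [CayleySix.rels, CayleySix.g])).symm,
    (PresentedGroup.mk_eq_mk_of_mul_inv_mem (by simp [CayleySix.rels, CayleySix.g])).symm⟩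

theorem lift_threeToSix_eq_one :
    ∀ r ∈ CayleyThree.rels, FreeGroup.lift threeToSix r = 1 := by
  have hg (i) : PresentedGroup.mk CayleySix.rels (CayleySix.g i) = .of i := rfl
  have rel {r} (hr : r ∈ CayleySix.rels) :
      PresentedGroup.mk CayleySix.rels r = 1 := PresentedGroup.one_of_mem hr
  obtain ⟨e₁, e₃, e₅⟩ := of_eq_of_six
  have h₁ := rel (.inr (.inl rfl))
  have h₂ := rel (.inr (.inr (.inr (.inr (.inl rfl)))))
  have hlong := rel (.inr (.inr (.inr (.inr (.inr (.inr (.inr (.inl rfl))))))))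
  have h₄ := rel (.inr (.inr (.inr (.inr (.inr (.inr (.inr (.inr (.inl rfl)))))))))
  simp only [map_tripleComm, map_simpleComm, map_mul, map_inv, hg, e₁, e₃, e₅] at h₁ h₂ hlong h₄
  have h₃ := (long_relator_eq_one_iff h₁).1 hlong
  rw [mul_inv_cancel_right] at h₂
  simp only [CayleyThree.rels, Set.mem_insert_iff, Set.mem_singleton_iff]
  rintro r (rfl | rfl | rfl | rfl) <;>
    simp only [map_tripleComm, map_simpleComm, map_mul, map_inv, map_pow, CayleyThree.g,
      FreeGroup.lift_apply_of]
  exacts [h₁, h₂, h₃, h₄]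

/-- The six-generator presented group `G₆` is isomorphic to the three-generator presented
group `G₃` via `γ₁ ↦ γ₁`, `γ₁' ↦ γ₁`, `γ₂ ↦ γ₂`, `γ₂' ↦ γ₂`, `γ₃ ↦ γ₃`, `γ₃' ↦ γ₃`.
(This is the simplification of the presentation of `π₁(ℂ² − S)` in the paper.) -/
theorem stmt_1 :
    ∃ e : PresentedGroup CayleySix.rels ≃* PresentedGroup CayleyThree.rels,
      e (PresentedGroup.of 0) = PresentedGroup.of 0 ∧
      e (PresentedGroup.of 1) = PresentedGroup.of 0 ∧
      e (PresentedGroup.of 2) = PresentedGroup.of 1 ∧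
      e (PresentedGroup.of 3) = PresentedGroup.of 1 ∧
      e (PresentedGroup.of 4) = PresentedGroup.of 2 ∧
      e (PresentedGroup.of 5) = PresentedGroup.of 2 := by
  obtain ⟨e₁, e₃, e₅⟩ := of_eq_of_six
  refine ⟨MonoidHom.toMulEquiv (PresentedGroup.toGroup lift_sixToThree_eq_one)
    (PresentedGroup.toGroup lift_threeToSix_eq_one) ?_ ?_, ?_⟩
  · refine PresentedGroup.ext fun i => ?_
    fin_cases i <;> simp [sixToThree, threeToSix, e₁, e₃, e₅]
  · refine PresentedGroup.ext fun i => ?_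
    fin_cases i <;> simp [sixToThree, threeToSix]
  · simp [sixToThree]
end

section
/- Let G₆ᵖ be the group presented by six generators γ₁, γ₁', γ₂, γ₂', γ₃, γ₃' subject to the relations: γ₂ = γ₂'; ⟨γ₁,γ₂'⟩ = ⟨γ₁',γ₂'⟩ = ⟨γ₁'γ₁γ₁'⁻¹, γ₂'⟩ = e; ⟨γ₂'γ₂γ₂'⁻¹, γ₃⟩ = ⟨γ₂'γ₂γ₂'⁻¹, γ₃'⟩ = ⟨γ₂'γ₂γ₂'⁻¹, γ₃'γ₃γ₃'⁻¹⟩ = e; γ₁⁻¹γ₁'⁻¹γ₂'⁻¹γ₃'γ₃γ₂'γ₂γ₂'⁻¹γ₃⁻¹γ₃'⁻¹γ₂'γ₁'γ₁ = γ₂'; [γ₁, γ₂'⁻¹γ₃γ₂'] = [γ₁', γ₂'⁻¹γ₃⁻¹γ₃'γ₃γ₂'] = e; [γ₁, γ₂'⁻¹γ₃γ₂'] = [γ₁, γ₂'⁻¹γ₃⁻¹γ₃'γ₃γ₂'] = e; γ₁ = γ₁'; γ₃ = γ₃'; and the projective relation γ₃'γ₃γ₂'γ₂γ₁'γ₁ =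 e. Let G₃ᵖ be the group presented by three generators γ₁, γ₂, γ₃ subject to the relations ⟨γ₁,γ₂⟩ = e, ⟨γ₂,γ₃⟩ = e, [γ₁, γ₂⁻¹γ₃γ₂] = e, γ₃²γ₂²γ₁² = e. Then there is a group isomorphism G₆ᵖ ≅ G₃ᵖ sending γ₁ ↦ γ₁, γ₁' ↦ γ₁, γ₂ ↦ γ₂, γ₂' ↦ γ₂, γ₃ ↦ γ₃, γ₃' ↦ γ₃. -/
namespace CayleySixProj

/-- Generators of the free group on six letters, indexed so that
`0 ↦ γ₁`, `1 ↦ γ₁'`, `2 ↦ γ₂`, `3 ↦ γ₂'`, `4 ↦ γ₃`, `5 ↦ γ₃'`. -/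
def g : Fin 6 → FreeGroup (Fin 6) := FreeGroup.of

/-- The relators of the six-generator projective presentation:
`γ₂ = γ₂'`; `⟨γ₁,γ₂'⟩ = ⟨γ₁',γ₂'⟩ = ⟨γ₁'γ₁γ₁'⁻¹,γ₂'⟩ = e`;
`⟨γ₂'γ₂γ₂'⁻¹,γ₃⟩ = ⟨γ₂'γ₂γ₂'⁻¹,γ₃'⟩ = ⟨γ₂'γ₂γ₂'⁻¹,γ₃'γ₃γ₃'⁻¹⟩ = e`;
`γ₁⁻¹γ₁'⁻¹γ₂'⁻¹γ₃'γ₃γ₂'γ₂γ₂'⁻¹γ₃⁻¹γ₃'⁻¹γ₂'γ₁'γ₁ = γ₂'`;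
`[γ₁,γ₂'⁻¹γ₃γ₂'] = [γ₁',γ₂'⁻¹γ₃⁻¹γ₃'γ₃γ₂'] = e`;
`[γ₁,γ₂'⁻¹γ₃γ₂'] = [γ₁,γ₂'⁻¹γ₃⁻¹γ₃'γ₃γ₂'] = e`; `γ₁ = γ₁'`; `γ₃ = γ₃'`;
and the projective relation `γ₃'γ₃γ₂'γ₂γ₁'γ₁ = e`. -/
def rels : Set (FreeGroup (Fin 6)) :=
  { g 2 * (g 3)⁻¹,
    tripleComm (g 0) (g 3),
    tripleComm (g 1) (g 3),
    tripleComm (g 1 * g 0 * (g 1)⁻¹) (g 3),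
    tripleComm (g 3 * g 2 * (g 3)⁻¹) (g 4),
    tripleComm (g 3 * g 2 * (g 3)⁻¹) (g 5),
    tripleComm (g 3 * g 2 * (g 3)⁻¹) (g 5 * g 4 * (g 5)⁻¹),
    ((g 0)⁻¹ * (g 1)⁻¹ * (g 3)⁻¹ * g 5 * g 4 * g 3 * g 2 * (g 3)⁻¹ * (g 4)⁻¹ * (g 5)⁻¹ *
        g 3 * g 1 * g 0) * (g 3)⁻¹,
    simpleComm (g 0) ((g 3)⁻¹ * g 4 * g 3),
    simpleComm (g 1) ((g 3)⁻¹ * (g 4)⁻¹ * g 5 * g 4 * g 3),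
    simpleComm (g 0) ((g 3)⁻¹ * (g 4)⁻¹ * g 5 * g 4 * g 3),
    g 0 * (g 1)⁻¹,
    g 4 * (g 5)⁻¹,
    g 5 * g 4 * g 3 * g 2 * g 1 * g 0 }

end CayleySixProj

namespace CayleyThreeProj

/-- Generators of the free group on three letters, indexed so that
`0 ↦ γ₁`, `1 ↦ γ₂`, `2 ↦ γ₃`. -/
def g : Fin 3 → FreeGroup (Fin 3) := FreeGroup.of

/-- The relators of the three-generator projective presentation:
`⟨γ₁,γ₂⟩ = e`, `⟨γ₂,γ₃⟩ = e`, `[γ₁,γ₂⁻¹γ₃γ₂] = e`, `γ₃²γ₂²γ₁² = e`. -/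
def rels : Set (FreeGroup (Fin 3)) :=
  { tripleComm (g 0) (g 1),
    tripleComm (g 1) (g 2),
    simpleComm (g 0) ((g 1)⁻¹ * g 2 * g 1),
    (g 2) ^ 2 * (g 1) ^ 2 * (g 0) ^ 2 }

end CayleyThreeProj

/-- If `a` and `b` satisfy the braid relation, then `b` commutes with `a²ba²`. -/
theorem mul_sq_mul_sq_of_braid {G : Type*} [Group G] {a b : G} (h : a * b * a = b * a * b) :
    b * a ^ 2 * b * a ^ 2 = a ^ 2 * b * a ^ 2 * b := by
  calc b * a ^ 2 * b * a ^ 2 = b * a * (a * b * a) * a := by simp only [pow_two, mul_assoc]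
    _ = b * a * (b * a * b) * a := by rw [h]
    _ = (b * a * b) * (a * b * a) := by simp only [mul_assoc]
    _ = (a * b * a) * (b * a * b) := by rw [h]
    _ = a * (b * a * b) * (a * b) := by simp only [mul_assoc]
    _ = a ^ 2 * b * a ^ 2 * b := by rw [← h]; simp only [pow_two, mul_assoc]

/-- In the presence of `c²b²a² = 1` and the braid relation for `a` and `b`, the long conjugation
relator of the six-generator presentation, after identifying primed and unprimed generators, is
trivial. -/
theorem conj_relator_eq_one {G : Type*} [Group G] {a b c : G} (h : a * b * a = b * a * b)
    (hp : c ^ 2 * b ^ 2 * a ^ 2 = 1) :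
    (a⁻¹ * a⁻¹ * b⁻¹ * c * c * b * c⁻¹ * c⁻¹ * b * a * a) * b⁻¹ = 1 := by
  have hc : c ^ 2 = (b ^ 2 * a ^ 2)⁻¹ := by
    rw [mul_assoc] at hp
    exact eq_inv_of_mul_eq_one_left hp
  calc (a⁻¹ * a⁻¹ * b⁻¹ * c * c * b * c⁻¹ * c⁻¹ * b * a * a) * b⁻¹
      = (a ^ 2)⁻¹ * b⁻¹ * c ^ 2 * b * (c ^ 2)⁻¹ * b * a ^ 2 * b⁻¹ := by
        simp [pow_two, mul_assoc]
    _ = (a ^ 2)⁻¹ * b⁻¹ * (a ^ 2)⁻¹ * (b * a ^ 2 * b * a ^ 2) * b⁻¹ := by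
        rw [hc]; simp [pow_two, mul_assoc]
    _ = 1 := by
        rw [mul_sq_mul_sq_of_braid h]; group

namespace CayleySixProj

/-- The images of the six generators in the three-generator group. -/
def toThree : Fin 6 → PresentedGroup CayleyThreeProj.rels :=
  ![.of 0, .of 0, .of 1, .of 1, .of 2, .of 2]

theorem lift_toThree_eq_one : ∀ r ∈ rels, FreeGroup.lift toThree r = 1 := by
  have h₁ : tripleComm (.of 0) (.of 1) = (1 : PresentedGroup CayleyThreeProj.rels) :=
    PresentedGroup.one_of_mem (x := tripleComm (CayleyThreeProj.g 0) (CayleyThreeProj.g 1))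
      (by simp [CayleyThreeProj.rels])
  have h₂ : tripleComm (.of 1) (.of 2) = (1 : PresentedGroup CayleyThreeProj.rels) :=
    PresentedGroup.one_of_mem (x := tripleComm (CayleyThreeProj.g 1) (CayleyThreeProj.g 2))
      (by simp [CayleyThreeProj.rels])
  have h₃ : simpleComm (.of 0) ((.of 1)⁻¹ * .of 2 * .of 1) =
      (1 : PresentedGroup CayleyThreeProj.rels) :=
    PresentedGroup.one_of_mem (x := simpleComm (CayleyThreeProj.g 0) ((CayleyThreeProj.g 1)⁻¹ *
      CayleyThreeProj.g 2 * CayleyThreeProj.g 1)) (by simp [CayleyThreeProj.rels])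
  have h₄ : (.of 2) ^ 2 * (.of 1) ^ 2 * (.of 0) ^ 2 =
      (1 : PresentedGroup CayleyThreeProj.rels) :=
    PresentedGroup.one_of_mem (x := CayleyThreeProj.g 2 ^ 2 * CayleyThreeProj.g 1 ^ 2 *
      CayleyThreeProj.g 0 ^ 2) (by simp [CayleyThreeProj.rels])
  have h₅ := conj_relator_eq_one (tripleComm_eq_one_iff.1 h₁) h₄
  rintro r (rfl | rfl | rfl | rfl | rfl | rfl | rfl | rfl | rfl | rfl | rfl | rfl | rfl | rfl) <;>
    simp only [map_tripleComm, map_simpleComm, map_mul, map_inv, g, FreeGroup.lift_apply_of,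
      toThree, Matrix.cons_val, mul_inv_cancel, mul_inv_cancel_right, inv_mul_cancel_right,
      h₁, h₂, h₃]
  · exact h₅
  · simpa only [pow_two, mul_assoc] using h₄

end CayleySixProj

namespace CayleyThreeProj

/-- The images of the three generators in the six-generator group. -/
def toSix : Fin 3 → PresentedGroup CayleySixProj.rels :=
  ![.of 0, .of 2, .of 4]

end CayleyThreeProj

namespace CayleySixProj

theorem of_zero_eq_of_one : (.of 0 : PresentedGroup rels) = .of 1 :=
  mul_inv_eq_one.1 (PresentedGroup.one_of_mem (x := g 0 * (g 1)⁻¹) (by simp [rels]))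

theorem of_two_eq_of_three : (.of 2 : PresentedGroup rels) = .of 3 :=
  mul_inv_eq_one.1 (PresentedGroup.one_of_mem (x := g 2 * (g 3)⁻¹) (by simp [rels]))

theorem of_four_eq_of_five : (.of 4 : PresentedGroup rels) = .of 5 :=
  mul_inv_eq_one.1 (PresentedGroup.one_of_mem (x := g 4 * (g 5)⁻¹) (by simp [rels]))

end CayleySixProj

namespace CayleyThreeProj

theorem lift_toSix_eq_one : ∀ r ∈ rels, FreeGroup.lift toSix r = 1 := by
  have h₁ : tripleComm (.of 0) (.of 3) = (1 : PresentedGroup CayleySixProj.rels) :=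
    PresentedGroup.one_of_mem (x := tripleComm (CayleySixProj.g 0) (CayleySixProj.g 3))
      (by simp [CayleySixProj.rels])
  have h₂ : tripleComm (.of 3 * .of 2 * (.of 3)⁻¹) (.of 4) =
      (1 : PresentedGroup CayleySixProj.rels) :=
    PresentedGroup.one_of_mem (x := tripleComm (CayleySixProj.g 3 * CayleySixProj.g 2 *
      (CayleySixProj.g 3)⁻¹) (CayleySixProj.g 4)) (by simp [CayleySixProj.rels])
  have h₃ : simpleComm (.of 0) ((.of 3)⁻¹ * .of 4 * .of 3) =
      (1 : PresentedGroup CayleySixProj.rels) :=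
    PresentedGroup.one_of_mem (x := simpleComm (CayleySixProj.g 0) ((CayleySixProj.g 3)⁻¹ *
      CayleySixProj.g 4 * CayleySixProj.g 3)) (by simp [CayleySixProj.rels])
  have h₄ : .of 5 * .of 4 * .of 3 * .of 2 * .of 1 * .of 0 =
      (1 : PresentedGroup CayleySixProj.rels) :=
    PresentedGroup.one_of_mem (x := CayleySixProj.g 5 * CayleySixProj.g 4 * CayleySixProj.g 3 *
      CayleySixProj.g 2 * CayleySixProj.g 1 * CayleySixProj.g 0) (by simp [CayleySixProj.rels])
  simp only [← CayleySixProj.of_zero_eq_of_one, ← CayleySixProj.of_two_eq_of_three,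
    ← CayleySixProj.of_four_eq_of_five, mul_inv_cancel_right] at h₁ h₂ h₃ h₄
  rintro r (rfl | rfl | rfl | rfl) <;>
    simp only [map_tripleComm, map_simpleComm, map_mul, map_inv, map_pow, g,
      FreeGroup.lift_apply_of, toSix, Matrix.cons_val, h₁, h₂, h₃]
  simpa only [pow_two, mul_assoc] using h₄

end CayleyThreeProj

/-- The six-generator presented group `G₆ᵖ` (with the projective relation) is isomorphic to
the three-generator presented group `G₃ᵖ` via `γ₁ ↦ γ₁`, `γ₁' ↦ γ₁`, `γ₂ ↦ γ₂`, `γ₂' ↦ γ₂`,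
`γ₃ ↦ γ₃`, `γ₃' ↦ γ₃`.
(This is the simplification of the presentation of `π₁(ℂP² − S̄)` in the paper.) -/
theorem stmt_2 :
    ∃ e : PresentedGroup CayleySixProj.rels ≃* PresentedGroup CayleyThreeProj.rels,
      e (PresentedGroup.of 0) = PresentedGroup.of 0 ∧
      e (PresentedGroup.of 1) = PresentedGroup.of 0 ∧
      e (PresentedGroup.of 2) = PresentedGroup.of 1 ∧
      e (PresentedGroup.of 3) = PresentedGroup.of 1 ∧
      e (PresentedGroup.of 4) = PresentedGroup.of 2 ∧
      e (PresentedGroup.of 5) = PresentedGroup.of 2 := by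
  refine ⟨MonoidHom.toMulEquiv
    (PresentedGroup.toGroup CayleySixProj.lift_toThree_eq_one)
    (PresentedGroup.toGroup CayleyThreeProj.lift_toSix_eq_one) ?_ ?_, ?_⟩
  · ext i
    fin_cases i <;>
      simp [CayleySixProj.toThree, CayleyThreeProj.toSix, CayleySixProj.of_zero_eq_of_one,
        CayleySixProj.of_two_eq_of_three, CayleySixProj.of_four_eq_of_five]
  · ext i
    fin_cases i <;> simp [CayleySixProj.toThree, CayleyThreeProj.toSix]
  · simp [CayleySixProj.toThree]
end

section
/- Let A = [[1,1],[0,1]], B = [[1,0],[−1,1]], C = [[2,1],[−1,0]], D = [[3,4],[−1,−1]] in SL(2,ℤ), and let Λ ⊆ ℤ² be the subgroup ℤ·(1,0) + ℤ·(0,2). Then for every matrix M in the subgroup of SL(2,ℤ) generated by {A, B², C², D²}, and for every v ∈ ℤ², the vector (M − Id)·v lies in Λ. (That is, for every element ρ of the monodromy subgroup, the image of ρ − Id is contained in the span of α and 2β.) -/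
/-- `A = [[1,1],[0,1]]` in `SL(2,ℤ)`. -/
def cayleyA : Matrix.SpecialLinearGroup (Fin 2) ℤ :=
  ⟨!![1, 1; 0, 1], by norm_num [Matrix.det_fin_two_of]⟩

/-- `B = [[1,0],[-1,1]]` in `SL(2,ℤ)`. -/
def cayleyB : Matrix.SpecialLinearGroup (Fin 2) ℤ :=
  ⟨!![1, 0; -1, 1], by norm_num [Matrix.det_fin_two_of]⟩

/-- `C = [[2,1],[-1,0]]` in `SL(2,ℤ)`. -/
def cayleyC : Matrix.SpecialLinearGroup (Fin 2) ℤ :=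
  ⟨!![2, 1; -1, 0], by norm_num [Matrix.det_fin_two_of]⟩

/-- `D = [[3,4],[-1,-1]]` in `SL(2,ℤ)`. -/
def cayleyD : Matrix.SpecialLinearGroup (Fin 2) ℤ :=
  ⟨!![3, 4; -1, -1], by norm_num [Matrix.det_fin_two_of]⟩

/-- The subgroup `Λ = ℤ·(1,0) + ℤ·(0,2)` of `ℤ²` (the span of `α` and `2β`). -/
def lambdaSubgroup : AddSubgroup (Fin 2 → ℤ) :=
  AddSubgroup.closure {![1, 0], ![0, 2]}

theorem mem_lambdaSubgroup_of_two_dvd {w : Fin 2 → ℤ} (h : 2 ∣ w 1) : w ∈ lambdaSubgroup := by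
  obtain ⟨k, hk⟩ := h
  have hw : w = w 0 • ![1, 0] + k • ![0, 2] := by
    ext i
    fin_cases i <;> simp [hk, mul_comm]
  rw [hw]
  exact add_mem (zsmul_mem (AddSubgroup.subset_closure (by simp)) _)
    (zsmul_mem (AddSubgroup.subset_closure (by simp)) _)

theorem closure_le_Gamma0_two :
    Subgroup.closure ({cayleyA, cayleyB ^ 2, cayleyC ^ 2, cayleyD ^ 2} :
      Set (Matrix.SpecialLinearGroup (Fin 2) ℤ)) ≤ CongruenceSubgroup.Gamma0 2 := by
  rw [Subgroup.closure_le]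
  rintro M (rfl | rfl | rfl | rfl) <;>
    rw [SetLike.mem_coe, CongruenceSubgroup.Gamma0_mem] <;> decide

theorem mulVec_sub_mem_lambdaSubgroup {M : Matrix.SpecialLinearGroup (Fin 2) ℤ}
    (hM : M ∈ CongruenceSubgroup.Gamma0 2) (v : Fin 2 → ℤ) :
    (M : Matrix (Fin 2) (Fin 2) ℤ).mulVec v - v ∈ lambdaSubgroup := by
  have h10 : (2 : ℤ) ∣ M 1 0 :=
    (ZMod.intCast_zmod_eq_zero_iff_dvd _ 2).1 (CongruenceSubgroup.Gamma0_mem.1 hM)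
  have h11 : (2 : ℤ) ∣ M 1 1 - 1 := by
    have hdet := M.det_coe
    rw [Matrix.det_fin_two] at hdet
    have hodd : Odd (M 0 0 * M 1 1) := by
      rw [eq_add_of_sub_eq hdet]
      exact odd_one.add_even ((even_iff_two_dvd.2 h10).mul_left _)
    exact even_iff_two_dvd.1 ((Int.odd_mul.1 hodd).2.sub_odd odd_one)
  apply mem_lambdaSubgroup_of_two_dvd
  have hrow : ((M : Matrix (Fin 2) (Fin 2) ℤ).mulVec v - v) 1 =
      M 1 0 * v 0 + (M 1 1 - 1) * v 1 := by
    simp only [Pi.sub_apply, Matrix.mulVec, dotProduct, Fin.sum_univ_two]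
    ring
  rw [hrow]
  exact dvd_add (h10.mul_right _) (h11.mul_right _)

/-- For every matrix `M` in the subgroup of `SL(2,ℤ)` generated by `{A, B², C², D²}`
(the monodromy subgroup of the elliptic pencil on the Cayley cubic) and every `v ∈ ℤ²`,
the vector `(M − Id)·v` lies in `Λ = ℤ·(1,0) + ℤ·(0,2)`. -/
theorem stmt_7 :
    ∀ M ∈ Subgroup.closure ({cayleyA, cayleyB ^ 2, cayleyC ^ 2, cayleyD ^ 2} :
        Set (Matrix.SpecialLinearGroup (Fin 2) ℤ)),
      ∀ v : Fin 2 → ℤ,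
        (M : Matrix (Fin 2) (Fin 2) ℤ).mulVec v - v ∈ lambdaSubgroup := by
  exact fun _ hM => mulVec_sub_mem_lambdaSubgroup (closure_le_Gamma0_two hM)
end

section
/- Let A = [[1,1],[0,1]], B = [[1,0],[−1,1]], C = [[2,1],[−1,0]], D = [[3,4],[−1,−1]] in SL(2,ℤ). Let N ⊆ ℤ² be the subgroup generated by all vectors (M − Id)·v as M ranges over {A, B², C², D²} and v ranges over ℤ². Then the quotient group ℤ²/N is isomorphic to ℤ/2ℤ. (This is the computation showing π₁(C − Sing) = ℤ/2 as the quotient of π₁(E) = ℤα ⊕ ℤβ by the relations γ = ρ(γ) for each factor ρ of the mapping class group factorization.) -/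
/-- The subgroup `N ⊆ ℤ²` generated by all vectors `(M − Id)·v` as `M` ranges over
`{A, B², C², D²}` and `v` ranges over `ℤ²`. -/
def relationsSubgroup : AddSubgroup (Fin 2 → ℤ) :=
  AddSubgroup.closure
    {w | ∃ M ∈ ({cayleyA, cayleyB ^ 2, cayleyC ^ 2, cayleyD ^ 2} :
          Set (Matrix.SpecialLinearGroup (Fin 2) ℤ)),
        ∃ v : Fin 2 → ℤ, w = (M : Matrix (Fin 2) (Fin 2) ℤ).mulVec v - v}

theorem coe_cayleyB_sq : ((cayleyB ^ 2 : Matrix.SpecialLinearGroup (Fin 2) ℤ) :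
    Matrix (Fin 2) (Fin 2) ℤ) = !![1, 0; -2, 1] := by
  rw [Matrix.SpecialLinearGroup.coe_pow, pow_two]
  decide

theorem coe_cayleyC_sq : ((cayleyC ^ 2 : Matrix.SpecialLinearGroup (Fin 2) ℤ) :
    Matrix (Fin 2) (Fin 2) ℤ) = !![3, 2; -2, -1] := by
  rw [Matrix.SpecialLinearGroup.coe_pow, pow_two]
  decide

theorem coe_cayleyD_sq : ((cayleyD ^ 2 : Matrix.SpecialLinearGroup (Fin 2) ℤ) :
    Matrix (Fin 2) (Fin 2) ℤ) = !![5, 8; -2, -3] := by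
  rw [Matrix.SpecialLinearGroup.coe_pow, pow_two]
  decide

/-- Reduction modulo 2 of the second coordinate. -/
def sndModTwo : (Fin 2 → ℤ) →+ ZMod 2 :=
  (Int.castAddHom (ZMod 2)).comp (Pi.evalAddMonoidHom (fun _ : Fin 2 => ℤ) 1)

theorem sndModTwo_apply (w : Fin 2 → ℤ) : sndModTwo w = (w 1 : ZMod 2) := rfl

theorem sndModTwo_surjective : Function.Surjective sndModTwo := fun z => by
  obtain ⟨n, rfl⟩ := ZMod.intCast_surjective z
  exact ⟨![0, n], rfl⟩

theorem mem_ker_sndModTwo {w : Fin 2 → ℤ} : w ∈ sndModTwo.ker ↔ (2 : ℤ) ∣ w 1 := by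
  rw [AddMonoidHom.mem_ker, sndModTwo_apply, ZMod.intCast_zmod_eq_zero_iff_dvd]
  rfl

theorem relationsSubgroup_le_ker : relationsSubgroup ≤ sndModTwo.ker := by
  refine (AddSubgroup.closure_le _).2 ?_
  rintro w ⟨M, hM, v, rfl⟩
  rw [SetLike.mem_coe, mem_ker_sndModTwo]
  rcases hM with rfl | rfl | rfl | rfl
  · simp [cayleyA, dotProduct]
  · rw [coe_cayleyB_sq]
    simp [dotProduct]
  · rw [coe_cayleyC_sq]
    simp [dotProduct]
    lia
  · rw [coe_cayleyD_sq]
    simp [dotProduct]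
    lia

theorem ker_le_relationsSubgroup : sndModTwo.ker ≤ relationsSubgroup := by
  intro w hw
  obtain ⟨k, hk⟩ := mem_ker_sndModTwo.1 hw
  have hA : ![w 0, 0] ∈ relationsSubgroup :=
    AddSubgroup.subset_closure ⟨cayleyA, by simp, ![0, w 0], by
      ext i
      fin_cases i <;> simp [cayleyA]⟩
  have hB : ![0, w 1] ∈ relationsSubgroup :=
    AddSubgroup.subset_closure ⟨cayleyB ^ 2, by simp, ![-k, 0], by
      rw [coe_cayleyB_sq]
      ext i
      fin_cases i <;> simp [hk, mul_comm]⟩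
  have hsum : w = ![w 0, 0] + ![0, w 1] := by
    ext i
    fin_cases i <;> simp
  rw [hsum]
  exact add_mem hA hB

/-- The quotient `ℤ²/N`, where `N` is generated by the images of `ρ − Id` for the factors
`ρ ∈ {A, B², C², D²}` of the mapping class group factorization, is isomorphic to `ℤ/2ℤ`.
This is the computation showing `π₁(C − Sing) = ℤ/2`. -/
theorem stmt_8 :
    Nonempty (((Fin 2 → ℤ) ⧸ relationsSubgroup) ≃+ ZMod 2) := by
  exact ⟨(QuotientAddGroup.quotientAddEquivOfEq
    (le_antisymm relationsSubgroup_le_ker ker_le_relationsSubgroup)).trans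
    (QuotientAddGroup.quotientKerEquivOfSurjective sndModTwo sndModTwo_surjective)⟩
end

section
/- Let G₃ be the group presented by three generators γ₁, γ₂, γ₃ subject to the relations ⟨γ₁,γ₂⟩ = e, ⟨γ₂,γ₃⟩ = e, [γ₂, γ₁²γ₃²] = e, [γ₁, γ₂⁻¹γ₃γ₂] = e, and let f : G₃ → Sym₃ be the homomorphism sending γ₁ ↦ (2 3), γ₂ ↦ (1 3), γ₃ ↦ (1 2). Let H ≤ G₃ be the subgroup of elements g with f(g)(1) = 1 (the stabilizer preimage). Then H is generated by the seven elements γ₁, γ₂γ₁⁻¹γ₃⁻¹, γ₃γ₂γ₃⁻¹, γ₃², γ₃γ₁²γ₃⁻¹, γ₃γ₁γ₂, and γ₃γ₁γ₃γ₁⁻¹γ₃⁻¹. -/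
namespace CayleyThree

/-- `γ₁`, `γ₂`, `γ₃` as elements of the presented group `G₃`. -/
def γ : Fin 3 → PresentedGroup rels := PresentedGroup.of

end CayleyThree

/-- Schreier's argument: if every `t x * s * (t (s⁻¹ • x))⁻¹` with `s` in a generating set `S`
lies in `K`, then the same holds for all group elements in place of `s`. -/
theorem schreier_mem_of_closure_eq_top {G X : Type*} [Group G] (f : G →* Equiv.Perm X)
    (t : X → G) (K : Subgroup G) {S : Set G} (hS : Subgroup.closure S = ⊤)
    (h : ∀ s ∈ S, ∀ x, t x * s * (t ((f s)⁻¹ x))⁻¹ ∈ K) (a : G) (x : X) :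
    t x * a * (t ((f a)⁻¹ x))⁻¹ ∈ K := by
  have ha : a ∈ Subgroup.closure S := hS ▸ Subgroup.mem_top a
  induction ha using Subgroup.closure_induction generalizing x with
  | mem s hs => exact h s hs x
  | one => simp
  | mul a b _ _ iha ihb =>
    convert K.mul_mem (iha x) (ihb ((f a)⁻¹ x)) using 1
    simp only [map_mul, mul_inv_rev, Equiv.Perm.mul_apply]
    group
  | inv a _ iha =>
    convert K.inv_mem (iha (f a x)) using 1
    simp [mul_assoc]

open CayleyThree in
/-- Let `f : G₃ → Sym₃` be the homomorphism sending `γ₁ ↦ (2 3)`, `γ₂ ↦ (1 3)`,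
`γ₃ ↦ (1 2)` (the points `1, 2, 3` being modelled by `0, 1, 2 : Fin 3`), and let
`H ≤ G₃` be the subgroup of elements `g` with `f(g)(1) = 1`.  Then `H` is generated by
the seven elements `γ₁`, `γ₂γ₁⁻¹γ₃⁻¹`, `γ₃γ₂γ₃⁻¹`, `γ₃²`, `γ₃γ₁²γ₃⁻¹`, `γ₃γ₁γ₂` and
`γ₃γ₁γ₃γ₁⁻¹γ₃⁻¹`  (the generators produced by the Reidemeister–Schreier method). -/
theorem stmt_9 (f : PresentedGroup CayleyThree.rels →* Equiv.Perm (Fin 3))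
    (h1 : f (γ 0) = Equiv.swap 1 2)
    (h2 : f (γ 1) = Equiv.swap 0 2)
    (h3 : f (γ 2) = Equiv.swap 0 1) :
    Subgroup.comap f (MulAction.stabilizer (Equiv.Perm (Fin 3)) (0 : Fin 3)) =
      Subgroup.closure
        { γ 0,
          γ 1 * (γ 0)⁻¹ * (γ 2)⁻¹,
          γ 2 * γ 1 * (γ 2)⁻¹,
          (γ 2) ^ 2,
          γ 2 * (γ 0) ^ 2 * (γ 2)⁻¹,
          γ 2 * γ 0 * γ 1,
          γ 2 * γ 0 * γ 2 * (γ 0)⁻¹ * (γ 2)⁻¹ } := by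
  apply le_antisymm
  · intro a ha
    have hfix : (f a)⁻¹ 0 = 0 := by
      rw [Equiv.Perm.inv_eq_iff_eq]
      exact (show f a 0 = 0 from ha).symm
    have key := schreier_mem_of_closure_eq_top f ![1, γ 2, γ 2 * γ 0]
      (Subgroup.closure
        { γ 0,
          γ 1 * (γ 0)⁻¹ * (γ 2)⁻¹,
          γ 2 * γ 1 * (γ 2)⁻¹,
          (γ 2) ^ 2,
          γ 2 * (γ 0) ^ 2 * (γ 2)⁻¹,
          γ 2 * γ 0 * γ 1,
          γ 2 * γ 0 * γ 2 * (γ 0)⁻¹ * (γ 2)⁻¹ })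
      (S := Set.range γ) (PresentedGroup.closure_range_of rels) ?_ a 0
    · simpa [hfix] using key
    · have swaps : (Equiv.swap 1 2 : Equiv.Perm (Fin 3)) 0 = 0 ∧
          (Equiv.swap 0 2 : Equiv.Perm (Fin 3)) 1 = 1 ∧
          (Equiv.swap 0 1 : Equiv.Perm (Fin 3)) 2 = 2 := by decide
      rintro _ ⟨j, rfl⟩ i
      fin_cases j <;> fin_cases i <;>
        simp only [Fin.zero_eta, Fin.mk_one, Fin.reduceFinMk, h1, h2, h3, Equiv.swap_inv,
          Equiv.swap_apply_left, Equiv.swap_apply_right, swaps, Matrix.cons_val, one_mul,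
          inv_one, mul_one, mul_inv_rev, mul_inv_cancel, mul_inv_cancel_right, one_mem,
          ← mul_assoc] <;>
        exact Subgroup.subset_closure (by simp [pow_two, mul_assoc])
  · rw [Subgroup.closure_le]
    rintro _ (rfl | rfl | rfl | rfl | rfl | rfl | rfl) <;>
      simp only [SetLike.mem_coe, Subgroup.mem_comap, MulAction.mem_stabilizer_iff, map_mul,
        map_inv, map_pow, h1, h2, h3] <;>
      decide
end

section
/- Let G₃ be the group presented by three generators γ₁, γ₂, γ₃ subject to the relations ⟨γ₁,γ₂⟩ = e, ⟨γ₂,γ₃⟩ = e, [γ₂, γ₁²γ₃²] = e, [γ₁, γ₂⁻¹γ₃γ₂] = e, let f : G₃ → Sym₃ be the homomorphism sending γ₁ ↦ (2 3), γ₂ ↦ (1 3), γ₃ ↦ (1 2), and let H ≤ G₃ be the subgroup of elements g with f(g)(1) = 1. Then the quotient of H by the normal closure in H of the six elements γ₁, γ₃γ₂γ₃⁻¹, γ₃², γ₃γ₁²γ₃⁻¹, γ₃γ₁γ₃γ₁⁻¹γ₃⁻¹, and γ₂² is isomorphic to ℤ/2ℤ, generated by the image of γ₂γ₁⁻¹γ₃⁻¹.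 -/
namespace CayleyThree

/-- The six elements of `G₃` whose loops must be killed (loops around `D = 2R + F`):
`γ₁`, `γ₃γ₂γ₃⁻¹`, `γ₃²`, `γ₃γ₁²γ₃⁻¹`, `γ₃γ₁γ₃γ₁⁻¹γ₃⁻¹` and `γ₂²`. -/
def loops : Set (PresentedGroup rels) :=
  { γ 0,
    γ 2 * γ 1 * (γ 2)⁻¹,
    (γ 2) ^ 2,
    γ 2 * (γ 0) ^ 2 * (γ 2)⁻¹,
    γ 2 * γ 0 * γ 2 * (γ 0)⁻¹ * (γ 2)⁻¹,
    (γ 1) ^ 2 }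

end CayleyThree

/-- If `X` generates `G` and the set `T` is stable, modulo a subgroup `M` acting on the left,
under right multiplication by the elements of `X` and their inverses, then `M * T = G`. -/
theorem Subgroup.exists_mul_inv_mem_of_closure_eq_top {G : Type*} [Group G] (M : Subgroup G)
    {T X : Set G} (hX : Subgroup.closure X = ⊤) (hT : 1 ∈ T)
    (hr : ∀ x ∈ X, ∀ t ∈ T, ∃ t' ∈ T, t * x * t'⁻¹ ∈ M)
    (hl : ∀ x ∈ X, ∀ t ∈ T, ∃ t' ∈ T, t' * x * t⁻¹ ∈ M) (g : G) :
    ∃ t ∈ T, g * t⁻¹ ∈ M := by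
  have hg : g ∈ Subgroup.closure X := hX ▸ Subgroup.mem_top g
  induction hg using Subgroup.closure_induction_right with
  | one => exact ⟨1, hT, by simp⟩
  | mul_right y _ x hx ih =>
    obtain ⟨t, ht, hy⟩ := ih
    obtain ⟨t', ht', h⟩ := hr x hx t ht
    exact ⟨t', ht', by simpa [mul_assoc] using M.mul_mem hy h⟩
  | mul_inv_cancel y _ x hx ih =>
    obtain ⟨t, ht, hy⟩ := ih
    obtain ⟨t', ht', h⟩ := hl x hx t ht
    exact ⟨t', ht', by simpa [mul_assoc] using M.mul_mem hy (M.inv_mem h)⟩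

namespace CayleyThree

theorem closure_γ : Subgroup.closure ({γ 0, γ 1, γ 2} : Set (PresentedGroup rels)) = ⊤ := by
  rw [← PresentedGroup.closure_range_of rels]
  congr 1
  ext x
  simp [Fin.exists_fin_succ, γ, eq_comm]

theorem γ_braid : γ 1 * γ 2 * γ 1 = γ 2 * γ 1 * γ 2 := by
  have h : tripleComm (γ 1) (γ 2) = 1 :=
    PresentedGroup.one_of_mem (rels := rels) (x := tripleComm (g 1) (g 2)) (by simp [rels])
  rw [tripleComm, mul_inv_eq_one, mul_inv_eq_iff_eq_mul, mul_inv_eq_iff_eq_mul] at h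
  exact h

theorem γ_comm : γ 0 * ((γ 1)⁻¹ * γ 2 * γ 1) = (γ 1)⁻¹ * γ 2 * γ 1 * γ 0 := by
  have h : simpleComm (γ 0) ((γ 1)⁻¹ * γ 2 * γ 1) = 1 :=
    PresentedGroup.one_of_mem (rels := rels) (x := simpleComm (g 0) ((g 1)⁻¹ * g 2 * g 1))
      (by simp [rels])
  rwa [simpleComm, mul_inv_eq_one, mul_inv_eq_iff_eq_mul] at h

/-- The involution of `Fin 3 × ZMod 2` exchanging the two fibres over `i` and `j`, and shifting
by `s` all fibres in the support of `swap i j`. -/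
def twistedSwap (i j : Fin 3) (s : ZMod 2) : Equiv.Perm (Fin 3 × ZMod 2) :=
  Function.Involutive.toPerm
    (fun p ↦ (Equiv.swap i j p.1, if Equiv.swap i j p.1 = p.1 then p.2 else p.2 + s))
    (by revert i j s; unfold Function.Involutive; decide)

/-- The images of the generators under the action of `G₃` on the double cover
`Fin 3 × ZMod 2` of the three sheets. -/
def signedGen : Fin 3 → Equiv.Perm (Fin 3 × ZMod 2) :=
  ![twistedSwap 1 2 1, twistedSwap 0 2 0, twistedSwap 0 1 0]

theorem lift_signedGen_eq_one : ∀ r ∈ rels, FreeGroup.lift signedGen r = 1 := by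
  simp only [rels, Set.mem_insert_iff, Set.mem_singleton_iff]
  rintro r (rfl | rfl | rfl | rfl) <;>
    simp only [tripleComm, simpleComm, g, map_mul, map_inv, map_pow, FreeGroup.lift_apply_of] <;>
    decide

/-- The action of `G₃` on `Fin 3 × ZMod 2`. -/
def signedRep : PresentedGroup rels →* Equiv.Perm (Fin 3 × ZMod 2) :=
  PresentedGroup.toGroup lift_signedGen_eq_one

theorem signedRep_γ (i : Fin 3) : signedRep (γ i) = signedGen i :=
  PresentedGroup.toGroup.of lift_signedGen_eq_one

theorem signedRep_add (x : PresentedGroup rels) (i : Fin 3) (s t : ZMod 2) :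
    signedRep x (i, s + t) = ((signedRep x (i, s)).1, (signedRep x (i, s)).2 + t) := by
  have hx : x ∈ Subgroup.closure {γ 0, γ 1, γ 2} := closure_γ ▸ Subgroup.mem_top x
  induction hx using Subgroup.closure_induction generalizing i s t with
  | mem x hx =>
    revert i s t
    rcases hx with rfl | rfl | rfl <;> rw [signedRep_γ] <;> decide
  | one => simp
  | mul x y _ _ hx hy => simp [hx, hy]
  | inv x _ hx =>
    rw [map_inv, Equiv.Perm.inv_eq_iff_eq, hx]
    simp

theorem signedRep_fst {f : PresentedGroup rels →* Equiv.Perm (Fin 3)}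
    (h1 : f (γ 0) = Equiv.swap 1 2) (h2 : f (γ 1) = Equiv.swap 0 2)
    (h3 : f (γ 2) = Equiv.swap 0 1) (x : PresentedGroup rels) (p : Fin 3 × ZMod 2) :
    (signedRep x p).1 = f x p.1 := by
  have hx : x ∈ Subgroup.closure {γ 0, γ 1, γ 2} := closure_γ ▸ Subgroup.mem_top x
  induction hx using Subgroup.closure_induction generalizing p with
  | mem x hx =>
    revert p
    rcases hx with rfl | rfl | rfl <;> simp only [signedRep_γ, h1, h2, h3] <;> decide
  | one => simp
  | mul x y _ _ hx hy => simp [hx, hy]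
  | inv x _ hx =>
    rw [map_inv, map_inv, eq_comm, Equiv.Perm.inv_eq_iff_eq, ← hx]
    simp

/-- The sign character of the stabilizer of the sheet `0`: how an element permutes the two points
above that sheet. -/
def fiberSign (f : PresentedGroup rels →* Equiv.Perm (Fin 3))
    (hf : ∀ x p, (signedRep x p).1 = f x p.1) :
    Subgroup.comap f (MulAction.stabilizer (Equiv.Perm (Fin 3)) (0 : Fin 3)) →*
      Multiplicative (ZMod 2) :=
  MonoidHom.mk' (fun x ↦ Multiplicative.ofAdd (signedRep x.1 (0, 0)).2) fun x y ↦ by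
    have hy : signedRep y.1 (0, 0) = (0, 0 + (signedRep y.1 (0, 0)).2) :=
      Prod.ext ((hf _ _).trans y.2) (zero_add _).symm
    rw [← ofAdd_add, Subgroup.coe_mul, map_mul, Equiv.Perm.mul_apply, hy, signedRep_add]
    simp

end CayleyThree

open CayleyThree in
/-- Let `f : G₃ → Sym₃` send `γ₁ ↦ (2 3)`, `γ₂ ↦ (1 3)`, `γ₃ ↦ (1 2)` (the points
`1, 2, 3` being modelled by `0, 1, 2 : Fin 3`), and let `H ≤ G₃` be the subgroup of
elements `g` with `f(g)(1) = 1`.  Then the quotient of `H` by the normal closure in `H`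
of the six elements `γ₁`, `γ₃γ₂γ₃⁻¹`, `γ₃²`, `γ₃γ₁²γ₃⁻¹`, `γ₃γ₁γ₃γ₁⁻¹γ₃⁻¹` and `γ₂²` is
isomorphic to `ℤ/2ℤ`, generated by the image of `γ₂γ₁⁻¹γ₃⁻¹`.  (This is the computation
of `π₁(C − Sing) ≅ ℤ/2ℤ` via the Reidemeister–Schreier method.) -/
theorem stmt_10 (f : PresentedGroup CayleyThree.rels →* Equiv.Perm (Fin 3))
    (h1 : f (γ 0) = Equiv.swap 1 2)
    (h2 : f (γ 1) = Equiv.swap 0 2)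
    (h3 : f (γ 2) = Equiv.swap 0 1)
    (hmem : γ 1 * (γ 0)⁻¹ * (γ 2)⁻¹ ∈
      Subgroup.comap f (MulAction.stabilizer (Equiv.Perm (Fin 3)) (0 : Fin 3))) :
    ∃ e : (↥(Subgroup.comap f (MulAction.stabilizer (Equiv.Perm (Fin 3)) (0 : Fin 3))) ⧸
        Subgroup.normalClosure
          (Subtype.val ⁻¹' CayleyThree.loops :
            Set ↥(Subgroup.comap f
              (MulAction.stabilizer (Equiv.Perm (Fin 3)) (0 : Fin 3))))) ≃*
        Multiplicative (ZMod 2),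
      e (QuotientGroup.mk ⟨γ 1 * (γ 0)⁻¹ * (γ 2)⁻¹, hmem⟩) =
        Multiplicative.ofAdd (1 : ZMod 2) := by
  set H := Subgroup.comap f (MulAction.stabilizer (Equiv.Perm (Fin 3)) (0 : Fin 3))
  set N : Subgroup H := Subgroup.normalClosure (Subtype.val ⁻¹' CayleyThree.loops)
  have memH : ∀ x, x ∈ H ↔ f x 0 = 0 := fun x ↦ Iff.rfl
  have loops_mem : ∀ x ∈ loops, x ∈ H := by
    rintro x (rfl | rfl | rfl | rfl | rfl | rfl) <;>
      simp only [memH, map_mul, map_inv, map_pow, h1, h2, h3] <;> decide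
  set w : H := ⟨γ 1 * (γ 0)⁻¹ * (γ 2)⁻¹, hmem⟩ with hw
  have mk_loop : ∀ x (hx : x ∈ loops),
      (QuotientGroup.mk ⟨x, loops_mem x hx⟩ : H ⧸ N) = 1 := fun x hx ↦
    (QuotientGroup.eq_one_iff _).2 (Subgroup.subset_normalClosure hx)
  have w_sq : (QuotientGroup.mk w : H ⧸ N) ^ 2 = 1 := by
    have hu : γ 2 * γ 1 * (γ 2)⁻¹ ∈ loops := by simp [loops]
    have hc : (γ 2) ^ 2 ∈ loops := by simp [loops]
    have ha : γ 2 * (γ 0) ^ 2 * (γ 2)⁻¹ ∈ loops := by simp [loops]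
    have key : w⁻¹ * ⟨_, loops_mem _ hu⟩ =
        (⟨_, loops_mem _ hu⟩ : H)⁻¹ * ⟨_, loops_mem _ hc⟩ * w * ⟨_, loops_mem _ ha⟩ := by
      apply Subtype.ext
      have h := congrArg (fun x ↦ γ 2 * x * (γ 2)⁻¹) γ_comm
      simp only [Subgroup.coe_mul, Subgroup.coe_inv, hw]
      convert h using 1 <;> group
    have key' := congrArg (QuotientGroup.mk : H → H ⧸ N) key
    simp only [QuotientGroup.mk_mul, QuotientGroup.mk_inv] at key'
    rw [mk_loop _ hu, mk_loop _ hc, mk_loop _ ha, inv_one, one_mul, one_mul, mul_one, mul_one]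
      at key'
    rw [sq, ← inv_eq_iff_mul_eq_one, key']
  set M : Subgroup (PresentedGroup rels) :=
    ((Subgroup.zpowers (QuotientGroup.mk w : H ⧸ N)).comap (QuotientGroup.mk' N)).map H.subtype
  have w_mem : γ 1 * (γ 0)⁻¹ * (γ 2)⁻¹ ∈ M := ⟨w, Subgroup.mem_zpowers _, rfl⟩
  have loop_mem : ∀ x ∈ loops, x ∈ M := fun x hx ↦
    ⟨⟨x, loops_mem x hx⟩, by simp [mk_loop x hx], rfl⟩
  have M_le : M ≤ H := Subgroup.map_subtype_le _
  have ha : γ 0 ∈ M := loop_mem _ (by simp [loops])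
  have hbb : γ 1 * γ 1 ∈ M := sq (γ 1) ▸ loop_mem _ (by simp [loops])
  have hcc : γ 2 * γ 2 ∈ M := sq (γ 2) ▸ loop_mem _ (by simp [loops])
  have hcbc : γ 2 * γ 1 * (γ 2)⁻¹ ∈ M := loop_mem _ (by simp [loops])
  have hcab : γ 2 * γ 0 * (γ 1)⁻¹ ∈ M := by
    simpa [mul_assoc] using M.inv_mem w_mem
  have hbac : γ 1 * γ 0 * (γ 2)⁻¹ ∈ M := by
    have h : γ 2 * (γ 0) ^ 2 * (γ 2)⁻¹ ∈ M := loop_mem _ (by simp [loops])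
    convert M.mul_mem w_mem h using 1
    group
  have hbcb : γ 1 * γ 2 * (γ 1)⁻¹ ∈ M := by
    have h : γ 1 * γ 2 * (γ 1)⁻¹ = (γ 2)⁻¹ * γ 1 * γ 2 := by
      rw [mul_inv_eq_iff_eq_mul, mul_assoc, mul_assoc, eq_inv_mul_iff_mul_eq]
      simpa [mul_assoc] using γ_braid.symm
    rw [h]
    convert M.mul_mem (M.mul_mem (M.inv_mem hcc) hcbc) hcc using 1
    group
  have mem_zpowers : ∀ x : H, (QuotientGroup.mk x : H ⧸ N) ∈
      Subgroup.zpowers (QuotientGroup.mk w : H ⧸ N) := by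
    intro x
    suffices hx : x.1 ∈ M by
      obtain ⟨y, hy, hyx⟩ := hx
      rwa [← Subtype.ext hyx]
    obtain ⟨t, ht, hxt⟩ := M.exists_mul_inv_mem_of_closure_eq_top
      (T := {1, γ 1, γ 2}) closure_γ (by simp)
      (by
        rintro _ (rfl | rfl | rfl) _ (rfl | rfl | rfl) <;>
          simp [ha, hbb, hcc, hcbc, hcab, hbac, hbcb])
      (by
        rintro _ (rfl | rfl | rfl) _ (rfl | rfl | rfl) <;>
          simp [ha, hbb, hcc, hcbc, hcab, hbac, hbcb])
      x.1
    have htH : t ∈ H := by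
      simpa [mul_assoc] using H.mul_mem (H.inv_mem (M_le hxt)) x.2
    rcases ht with rfl | rfl | rfl
    · simpa using hxt
    · rw [memH, h2] at htH
      exact absurd htH (by decide)
    · rw [memH, h3] at htH
      exact absurd htH (by decide)
  have eq_or : ∀ q : H ⧸ N, q = 1 ∨ q = QuotientGroup.mk w := by
    intro q
    induction q using QuotientGroup.induction_on with
    | H x =>
      obtain ⟨n, hn⟩ := mem_zpowers x
      rw [← hn]
      obtain ⟨k, rfl | rfl⟩ := Int.even_or_odd' n <;>
        simp [zpow_add, zpow_mul, zpow_ofNat, w_sq]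
  have hφN : N ≤ (fiberSign f (signedRep_fst h1 h2 h3)).ker := by
    refine Subgroup.normalClosure_le_normal ?_
    rintro ⟨x, hx⟩ (rfl | rfl | rfl | rfl | rfl | rfl) <;>
      simp only [SetLike.mem_coe, MonoidHom.mem_ker, fiberSign, MonoidHom.mk'_apply, map_mul, map_inv,
        map_pow, signedRep_γ] <;> decide
  have hφw : fiberSign f (signedRep_fst h1 h2 h3) w = Multiplicative.ofAdd 1 := by
    simp only [hw, fiberSign, MonoidHom.mk'_apply, map_mul, map_inv, signedRep_γ]
    decide
  set φ := QuotientGroup.lift N (fiberSign f (signedRep_fst h1 h2 h3)) hφN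
  have hφ : φ (QuotientGroup.mk w) = Multiplicative.ofAdd 1 := hφw
  refine ⟨MulEquiv.ofBijective φ ⟨(injective_iff_map_eq_one φ).2 fun q hq ↦ ?_, fun z ↦ ?_⟩, hφ⟩
  · refine (eq_or q).resolve_right ?_
    rintro rfl
    exact absurd (hφ.symm.trans hq) (by decide)
  · obtain rfl | rfl : z = 1 ∨ z = Multiplicative.ofAdd 1 := by revert z; decide
    exacts [⟨1, map_one φ⟩, ⟨_, hφ⟩]
end

section
/- Let F be the polynomial 4(X₀³+X₁³+X₂³+X₃³) − (X₀+X₁+X₂+X₃)³ in ℂ[X₀,X₁,X₂,X₃], let C ⊂ ℙ(ℂ⁴) be the Cayley cubic, i.e. the set of projective points whose (equivalently, some) representative vector v satisfies F(v) = 0, and let Sing ⊂ C be the set of four points consisting of [1:1:1:−1] and its coordinate permutations. Then the fundamental group of the topological space C − Sing (with the subspace topology from the quotient topology on ℙ(ℂ⁴)), based at the point [1:−1:0:0], is isomorphic to ℤ/2ℤ. -/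
open MvPolynomial
open scoped LinearAlgebra.Projectivization

/-- The projectivization `ℙ(ℂ⁴)` carries the quotient topology from `ℂ⁴ − {0}`. -/
noncomputable instance : TopologicalSpace (ℙ ℂ (Fin 4 → ℂ)) :=
  inferInstanceAs (TopologicalSpace (Quotient (projectivizationSetoid ℂ (Fin 4 → ℂ))))

/-- The defining polynomial of the Cayley cubic:
`F = 4(X₀³ + X₁³ + X₂³ + X₃³) − (X₀ + X₁ + X₂ + X₃)³` in `ℂ[X₀,X₁,X₂,X₃]`. -/
noncomputable def cayleyF : MvPolynomial (Fin 4) ℂ :=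
  4 * (∑ i : Fin 4, X i ^ 3) - (∑ i : Fin 4, X i) ^ 3

/-- The vector `(1, 1, 1, −1) ∈ ℂ⁴`. -/
def cayleyW : Fin 4 → ℂ := ![1, 1, 1, -1]

lemma cayleyW_ne_zero (j : Fin 4) : cayleyW j ≠ 0 := by
  fin_cases j <;> norm_num [cayleyW]

/-- Any coordinate permutation of `(1,1,1,−1)` is a nonzero vector. -/
lemma permW_ne_zero (σ : Equiv.Perm (Fin 4)) : (fun i => cayleyW (σ i)) ≠ 0 := by
  intro h
  exact cayleyW_ne_zero (σ (σ.symm 0)) (congrFun h (σ.symm 0))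

/-- The Cayley cubic `C ⊂ ℙ(ℂ⁴)`: the set of projective points all (equivalently, some)
of whose representative vectors `v` satisfy `F(v) = 0`. -/
def cayleyCubic : Set (ℙ ℂ (Fin 4 → ℂ)) :=
  {p | ∀ (v : Fin 4 → ℂ) (hv : v ≠ 0), Projectivization.mk ℂ v hv = p →
    MvPolynomial.eval v cayleyF = 0}

/-- The set of the four singular points of the Cayley cubic:
`[1:1:1:−1]` and its coordinate permutations. -/
def cayleySing : Set (ℙ ℂ (Fin 4 → ℂ)) :=
  {p | ∃ σ : Equiv.Perm (Fin 4),
    p = Projectivization.mk ℂ (fun i => cayleyW (σ i)) (permW_ne_zero σ)}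

lemma base_ne_zero : (![1, -1, 0, 0] : Fin 4 → ℂ) ≠ 0 := by
  intro h
  have h0 := congrFun h 0
  norm_num at h0

/-- The basepoint `[1:−1:0:0] ∈ ℙ(ℂ⁴)`. -/
noncomputable def basePoint : ℙ ℂ (Fin 4 → ℂ) :=
  Projectivization.mk ℂ ![1, -1, 0, 0] base_ne_zero

lemma basePoint_mem_cubic : basePoint ∈ cayleyCubic := by
  intro v hv hmk
  rw [basePoint, Projectivization.mk_eq_mk_iff] at hmk
  obtain ⟨a, rfl⟩ := hmk
  simp [cayleyF, Fin.sum_univ_four, Pi.smul_apply, smul_eq_mul]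
  ring

lemma basePoint_not_mem_sing : basePoint ∉ cayleySing := by
  rintro ⟨σ, hσ⟩
  rw [basePoint, Projectivization.mk_eq_mk_iff] at hσ
  obtain ⟨a, ha⟩ := hσ
  have h2 := congrFun ha 2
  simp [Pi.smul_apply, smul_eq_mul] at h2
  exact cayleyW_ne_zero (σ 2) (by
    rcases mul_eq_zero.mp h2 with h | h
    · exact absurd h a.ne_zero
    · exact h)

/-- The basepoint `[1:−1:0:0]` as a point of `C − Sing`. -/
noncomputable def basePoint' : ↥(cayleyCubic \ cayleySing) :=
  ⟨basePoint, basePoint_mem_cubic, basePoint_not_mem_sing⟩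

open Path in
/-- A space covered by open sets, any two of which meet in a subset all of whose points can be
joined to a common base point, is simply connected as soon as the loops contained in a single
member of the cover are null-homotopic. -/
theorem simplyConnectedSpace_of_openCover {ι X : Type*} [TopologicalSpace X] (U : ι → Set X)
    (x₀ : X) (hU : ∀ i, IsOpen (U i)) (hcov : ∀ p, ∃ i, p ∈ U i)
    (hj : ∀ i j, ∀ p ∈ U i ∩ U j, JoinedIn (U i ∩ U j) x₀ p)
    (hnull : ∀ i (γ : Path x₀ x₀), (∀ t, γ t ∈ U i) → γ.Homotopic (Path.refl x₀)) :
    SimplyConnectedSpace X := by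
  have hpaths : ∀ i {p : X} (γ δ : Path x₀ p), (∀ t, γ t ∈ U i) → (∀ t, δ t ∈ U i) →
      Homotopic.Quotient.mk γ = Homotopic.Quotient.mk δ := by
    intro i p γ δ hγ hδ
    have h : Homotopic.Quotient.trans (Homotopic.Quotient.mk γ) (Homotopic.Quotient.symm (Homotopic.Quotient.mk δ)) =
        Homotopic.Quotient.refl x₀ := by
      rw [← Homotopic.Quotient.mk_symm, ← Homotopic.Quotient.mk_trans, ← Homotopic.Quotient.mk_refl]
      refine Homotopic.Quotient.eq.2 (hnull i _ fun t => ?_)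
      have : (γ.trans δ.symm) t ∈ Set.range (γ.trans δ.symm) := ⟨t, rfl⟩
      rw [Path.trans_range, Path.symm_range] at this
      rcases this with ⟨s, hs⟩ | ⟨s, hs⟩
      · exact hs ▸ hγ s
      · exact hs ▸ hδ s
    calc Homotopic.Quotient.mk γ
      _ = Homotopic.Quotient.trans (Homotopic.Quotient.trans (Homotopic.Quotient.mk γ) (Homotopic.Quotient.symm (Homotopic.Quotient.mk δ)))
            (Homotopic.Quotient.mk δ) := by simp
      _ = Homotopic.Quotient.mk δ := by rw [h]; simp
  have hc : ∀ p, ∃ c : Path.Homotopic.Quotient x₀ p, ∀ i (γ : Path x₀ p), (∀ t, γ t ∈ U i) →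
      Homotopic.Quotient.mk γ = c := by
    intro p
    obtain ⟨i, hi⟩ := hcov p
    refine ⟨Homotopic.Quotient.mk (hj i i p ⟨hi, hi⟩).somePath, fun j γ hγ => ?_⟩
    have hp : p ∈ U i ∩ U j := ⟨hi, by simpa using hγ 1⟩
    rw [hpaths j γ (hj i j p hp).somePath hγ fun t => ((hj i j p hp).somePath_mem t).2]
    exact hpaths i _ _ (fun t => ((hj i j p hp).somePath_mem t).1)
      fun t => ((hj i i p ⟨hi, hi⟩).somePath_mem t).1
  choose c hc using hc
  have hsmall : ∀ i {a b : X} (γ : Path a b), (∀ t, γ t ∈ U i) →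
      Homotopic.Quotient.trans (c a) (Homotopic.Quotient.mk γ) = c b := by
    intro i a b γ hγ
    have ha : a ∈ U i ∩ U i := ⟨by simpa using hγ 0, by simpa using hγ 0⟩
    have hmem := (hj i i a ha).somePath_mem
    rw [← hc a i (hj i i a ha).somePath fun t => (hmem t).1, ← Homotopic.Quotient.mk_trans]
    refine hc b i _ fun t => ?_
    have : ((hj i i a ha).somePath.trans γ) t ∈ Set.range ((hj i i a ha).somePath.trans γ) :=
      ⟨t, rfl⟩
    rw [Path.trans_range] at this
    rcases this with ⟨s, hs⟩ | ⟨s, hs⟩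
    · exact hs ▸ (hmem s).1
    · exact hs ▸ hγ s
  have hall : ∀ {a b : X} (γ : Path a b), Homotopic.Quotient.trans (c a) (Homotopic.Quotient.mk γ) = c b := by
    intro a b γ
    obtain ⟨t, ht0, htm, ⟨n, hn⟩, ht⟩ := exists_monotone_Icc_subset_open_cover_unitInterval
      (c := fun i => γ ⁻¹' U i) (fun i => (hU i).preimage γ.continuous)
      (fun s _ => Set.mem_iUnion.2 (hcov (γ s)))
    have hind : ∀ k, Homotopic.Quotient.trans (c (γ 0)) (Homotopic.Quotient.mk (γ.subpath 0 (t k))) =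
        c (γ (t k)) := by
      intro k
      induction k with
      | zero =>
        rw [ht0, Path.subpath_self, Homotopic.Quotient.mk_refl]
        simp
      | succ k ih =>
        obtain ⟨i, hi⟩ := ht k
        have h1 := hsmall i (γ.subpath (t k) (t (k + 1))) fun s => by
          have : γ.subpath (t k) (t (k + 1)) s ∈ Set.range (γ.subpath (t k) (t (k + 1))) :=
            ⟨s, rfl⟩
          rw [Path.range_subpath_of_le _ _ _ (htm k.le_succ)] at this
          obtain ⟨s', hs', h⟩ := this
          exact h ▸ hi hs'
        rw [← h1, ← ih, Homotopic.Quotient.trans_assoc, ← Homotopic.Quotient.mk_trans]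
        congr 1
        exact Homotopic.Quotient.eq.2 ⟨(Path.Homotopy.subpathTransSubpath γ 0 (t k) (t (k + 1))).symm⟩
    have hlast := hind n
    rw [hn n le_rfl, Path.subpath_zero_one] at hlast
    have hcast : ∀ (a' b' : X) (ha : a' = a) (hb : b' = b),
        Homotopic.Quotient.trans (c a') (Homotopic.Quotient.mk (γ.cast ha hb)) = c b' →
        Homotopic.Quotient.trans (c a) (Homotopic.Quotient.mk γ) = c b := by
      rintro _ _ rfl rfl h
      exact h
    exact hcast _ _ _ _ hlast
  refine simply_connected_iff_paths_homotopic'.2 ⟨⟨⟨x₀⟩, fun a b => ?_⟩, fun {a b} p q => ?_⟩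
  · obtain ⟨i, hi⟩ := hcov a
    obtain ⟨j, hj'⟩ := hcov b
    exact (hj i i a ⟨hi, hi⟩).joined.symm.trans (hj j j b ⟨hj', hj'⟩).joined
  · refine Homotopic.Quotient.eq.1 ?_
    have h := congrArg (Homotopic.Quotient.trans (Homotopic.Quotient.symm (c a))) ((hall p).trans (hall q).symm)
    simpa [← Homotopic.Quotient.trans_assoc] using h

/-- If a subset `U` of `X` is a retract of a simply connected space that maps to `X`, then
every loop of `X` contained in `U` is null-homotopic. -/
theorem homotopic_refl_of_factors {X Y : Type*} [TopologicalSpace X] [TopologicalSpace Y]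
    [SimplyConnectedSpace Y] {U : Set X} (ρ : C(U, Y)) (ψ : C(Y, X)) (h : ∀ u : U, ψ (ρ u) = u)
    {x : X} (γ : Path x x) (hγ : ∀ t, γ t ∈ U) : γ.Homotopic (Path.refl x) := by
  have hx : x ∈ U := by simpa using hγ 0
  let γ' : Path (⟨x, hx⟩ : U) ⟨x, hx⟩ :=
    { toFun := fun t => ⟨γ t, hγ t⟩
      source' := by simp
      target' := by simp }
  have h1 := (SimplyConnectedSpace.paths_homotopic (γ'.map ρ.continuous) (Path.refl _)).map ψ
  have h2 := h1.pathCast (h ⟨x, hx⟩).symm (h ⟨x, hx⟩).symm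
  have e1 : (((γ'.map ρ.continuous).map ψ.continuous).cast (h ⟨x, hx⟩).symm (h ⟨x, hx⟩).symm) =
      γ := by
    ext t
    exact h ⟨γ t, hγ t⟩
  have e2 : (((Path.refl (ρ ⟨x, hx⟩)).map ψ.continuous).cast (h ⟨x, hx⟩).symm (h ⟨x, hx⟩).symm) =
      Path.refl x := by
    ext t
    exact h ⟨x, hx⟩
  rwa [e1, e2] at h2

/-- A subset `W` of `ℂ²` such that every complex line through a point of `W` leaves `W` in only
countably many points. -/
def LineDense (W : Set (ℂ × ℂ)) : Prop :=
  ∀ p ∈ W, ∀ q, {t : ℂ | p + t • (q - p) ∉ W}.Countable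

namespace LineDense

theorem univ : LineDense Set.univ := fun p _ q => by simp

theorem inter {W W' : Set (ℂ × ℂ)} (h : LineDense W) (h' : LineDense W') :
    LineDense (W ∩ W') := fun p hp q =>
  ((h p hp.1 q).union (h' p hp.2 q)).mono fun t ht => by
    by_contra hc
    simp only [Set.mem_union, Set.mem_ofPred_eq, not_or, not_not] at hc
    exact ht hc

theorem union {W W' : Set (ℂ × ℂ)} (h : LineDense W) (h' : LineDense W') :
    LineDense (W ∪ W') := by
  rintro p (hp | hp) q
  · exact (h p hp q).mono fun t ht hc => ht (Or.inl hc)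
  · exact (h' p hp q).mono fun t ht hc => ht (Or.inr hc)

theorem countable_affine {a b : ℂ} (ha : a ≠ 0) : {t : ℂ | a + t * (b - a) = 0}.Countable := by
  refine Set.Subsingleton.countable fun s hs t ht => ?_
  have hs' : a + s * (b - a) = 0 := hs
  have ht' : a + t * (b - a) = 0 := ht
  have hba : b - a ≠ 0 := fun h => ha (by simpa [h] using hs')
  exact mul_right_cancel₀ hba (by linear_combination hs' - ht')

theorem fst_ne (c : ℂ) : LineDense {p | p.1 ≠ c} := fun p hp q =>
  (countable_affine (b := q.1 - c) (sub_ne_zero.2 hp)).mono fun t ht => by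
    simp only [Set.mem_ofPred_eq, not_not, Prod.fst_add, Prod.smul_fst, Prod.fst_sub,
      smul_eq_mul] at ht ⊢
    linear_combination ht

theorem snd_ne (c : ℂ) : LineDense {p | p.2 ≠ c} := fun p hp q =>
  (countable_affine (b := q.2 - c) (sub_ne_zero.2 hp)).mono fun t ht => by
    simp only [Set.mem_ofPred_eq, not_not, Prod.snd_add, Prod.smul_snd, Prod.snd_sub,
      smul_eq_mul] at ht ⊢
    linear_combination ht

theorem fst_sq_ne_one : LineDense {p | p.1 ^ 2 ≠ 1} := by
  convert (fst_ne 1).inter (fst_ne (-1)) using 1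
  ext p
  simp [sq_eq_one_iff]

theorem snd_sq_ne_one : LineDense {p | p.2 ^ 2 ≠ 1} := by
  convert (snd_ne 1).inter (snd_ne (-1)) using 1
  ext p
  simp [sq_eq_one_iff]

theorem joinedIn {W : Set (ℂ × ℂ)} (h : LineDense W) {p q : ℂ × ℂ} (hp : p ∈ W) (hq : q ∈ W) :
    JoinedIn W p q := by
  have hconn := (h p hp q).isPathConnected_compl_of_one_lt_rank
    (by rw [Complex.rank_real_complex]; norm_num)
  have h01 := hconn.joinedIn 0 (by simpa using hp) 1 (by simpa using hq)
  have := h01.map_continuousOn (f := fun t : ℂ => p + t • (q - p)) (by fun_prop)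
  simp only [zero_smul, add_zero, one_smul, add_sub_cancel] at this
  refine this.mono ?_
  rintro _ ⟨t, ht, rfl⟩
  simpa using ht

end LineDense

/-- The plane `ℂ²` with the four points `(±1, ±1)` removed. -/
def puncturedPlane : Set (ℂ × ℂ) := {p | p.1 ^ 2 ≠ 1} ∪ {p | p.2 ^ 2 ≠ 1}

theorem LineDense.joinedIn_subtype {V W : Set (ℂ × ℂ)} (hV : LineDense V) (hW : LineDense W)
    {p q : W} (hp : (p : ℂ × ℂ) ∈ V) (hq : (q : ℂ × ℂ) ∈ V) :
    JoinedIn {x : W | (x : ℂ × ℂ) ∈ V} p q := by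
  obtain ⟨γ, hγ⟩ := (hV.inter hW).joinedIn ⟨hp, p.2⟩ ⟨hq, q.2⟩
  exact ⟨⟨⟨fun t => ⟨γ t, (hγ t).2⟩, by fun_prop⟩, by simp, by simp⟩, fun t => (hγ t).1⟩

theorem lineDense_puncturedPlane : LineDense puncturedPlane :=
  LineDense.fst_sq_ne_one.union LineDense.snd_sq_ne_one

theorem homotopic_refl_of_fst_sq_ne_one {x : puncturedPlane}
    (hx₂ : (x : ℂ × ℂ).2 ^ 2 ≠ 1) (γ : Path x x) (hγ : ∀ t, (γ t : ℂ × ℂ).1 ^ 2 ≠ 1) :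
    γ.Homotopic (Path.refl x) := by
  let δ : Path x x :=
    { toFun := fun t => ⟨((γ t : ℂ × ℂ).1, (x : ℂ × ℂ).2), Or.inr hx₂⟩
      continuous_toFun := by fun_prop
      source' := by simp
      target' := by simp }
  have h1 : γ.Homotopic δ :=
    ⟨{  toFun := fun s => ⟨((γ s.2 : ℂ × ℂ).1,
          (γ s.2 : ℂ × ℂ).2 + (s.1 : ℝ) * ((x : ℂ × ℂ).2 - (γ s.2 : ℂ × ℂ).2)), Or.inl (hγ s.2)⟩
        continuous_toFun := by fun_prop
        map_zero_left := fun t => by simp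
        map_one_left := fun t => by simp [δ]
        prop' := fun s t ht => by rcases ht with rfl | rfl <;> simp }⟩
  have h2 : δ.Homotopic (Path.refl x) :=
    ⟨{  toFun := fun s => ⟨((γ s.2 : ℂ × ℂ).1 +
          (s.1 : ℝ) * ((x : ℂ × ℂ).1 - (γ s.2 : ℂ × ℂ).1), (x : ℂ × ℂ).2), Or.inr hx₂⟩
        continuous_toFun := by fun_prop
        map_zero_left := fun t => by simp [δ]
        map_one_left := fun t => by simp
        prop' := fun s t ht => by rcases ht with rfl | rfl <;> simp [δ] }⟩
  exact h1.trans h2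

theorem homotopic_refl_of_snd_sq_ne_one {x : puncturedPlane}
    (hx₁ : (x : ℂ × ℂ).1 ^ 2 ≠ 1) (γ : Path x x) (hγ : ∀ t, (γ t : ℂ × ℂ).2 ^ 2 ≠ 1) :
    γ.Homotopic (Path.refl x) := by
  let σ : C(puncturedPlane, puncturedPlane) :=
    ⟨fun p => ⟨(p : ℂ × ℂ).swap, p.2.symm⟩, by fun_prop⟩
  have h := (homotopic_refl_of_fst_sq_ne_one (x := σ x) hx₁ (γ.map σ.continuous) hγ).map σ
  exact h

instance : SimplyConnectedSpace puncturedPlane := by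
  refine simplyConnectedSpace_of_openCover
    (fun b : Bool => cond b {p : puncturedPlane | (p : ℂ × ℂ).1 ^ 2 ≠ 1}
      {p : puncturedPlane | (p : ℂ × ℂ).2 ^ 2 ≠ 1})
    ⟨(0, 0), by simp [puncturedPlane]⟩ ?_ ?_ ?_ ?_
  · rintro (_ | _)
    · exact isOpen_ne.preimage (by fun_prop : Continuous fun p : puncturedPlane => (p : ℂ × ℂ).2 ^ 2)
    · exact isOpen_ne.preimage (by fun_prop : Continuous fun p : puncturedPlane => (p : ℂ × ℂ).1 ^ 2)
  · rintro ⟨p, hp | hp⟩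
    · exact ⟨true, hp⟩
    · exact ⟨false, hp⟩
  · rintro i j p ⟨hi, hj⟩
    have key : ∀ b : Bool, LineDense (cond b {p | p.1 ^ 2 ≠ 1} {p | p.2 ^ 2 ≠ 1}) := by
      rintro (_ | _)
      · exact LineDense.snd_sq_ne_one
      · exact LineDense.fst_sq_ne_one
    convert ((key i).inter (key j)).joinedIn_subtype lineDense_puncturedPlane (p := ⟨(0, 0), by simp [puncturedPlane]⟩) (q := p) ?_ ?_ using 1
    · cases i <;> cases j <;> rfl
    · cases i <;> cases j <;> simp
    · cases i <;> cases j <;> exact ⟨hi, hj⟩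
  · rintro (_ | _) γ hγ
    · exact homotopic_refl_of_snd_sq_ne_one (by simp) γ hγ
    · exact homotopic_refl_of_fst_sq_ne_one (by simp) γ hγ

section ProjectiveSpace

open Projectivization Topology

theorem Projectivization.mk_eq_mk_iff_mul {n : ℕ} {v w : Fin n → ℂ} (hv : v ≠ 0) (hw : w ≠ 0) :
    mk ℂ v hv = mk ℂ w hw ↔ ∀ i j, v i * w j = v j * w i := by
  rw [mk_eq_mk_iff']
  constructor
  · rintro ⟨a, rfl⟩ i j
    simp only [Pi.smul_apply, smul_eq_mul]
    ring
  · intro h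
    obtain ⟨j, hj⟩ := Function.ne_iff.1 hw
    refine ⟨v j / w j, funext fun i => ?_⟩
    simp only [Pi.smul_apply, smul_eq_mul]
    have hj' : w j ≠ 0 := hj
    field_simp
    linear_combination -h i j

theorem continuous_coe_apply {n : ℕ} (i : Fin n) :
    Continuous fun v : {v : Fin n → ℂ // v ≠ 0} => v.1 i :=
  (continuous_apply i).comp continuous_subtype_val

theorem Projectivization.isOpenQuotientMap_mk' {n : ℕ} [TopologicalSpace (ℙ ℂ (Fin n → ℂ))]
    (h : IsQuotientMap (mk' ℂ (V := Fin n → ℂ))) :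
    IsOpenQuotientMap (mk' ℂ (V := Fin n → ℂ)) := by
  refine ⟨h.surjective, h.continuous, fun U hU => ?_⟩
  rw [← h.isOpen_preimage]
  have : mk' ℂ ⁻¹' (mk' ℂ '' U) = ⋃ a : ℂˣ, (fun v : {v : Fin n → ℂ // v ≠ 0} =>
      (⟨a • v.1, (smul_ne_zero_iff_ne a).2 v.2⟩ : {v : Fin n → ℂ // v ≠ 0})) ⁻¹' U := by
    ext v
    simp only [Set.mem_preimage, Set.mem_image, Set.mem_iUnion]
    constructor
    · rintro ⟨w, hw, hwv⟩
      obtain ⟨a, ha⟩ := (mk_eq_mk_iff ℂ _ _ w.2 v.2).1 hwv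
      exact ⟨a, by simpa only [ha] using hw⟩
    · rintro ⟨a, ha⟩
      exact ⟨_, ha, (mk_eq_mk_iff ℂ _ _ _ _).2 ⟨a, rfl⟩⟩
  rw [this]
  exact isOpen_iUnion fun a => hU.preimage (by fun_prop)

theorem Projectivization.t2Space {n : ℕ} [TopologicalSpace (ℙ ℂ (Fin n → ℂ))]
    (h : IsQuotientMap (mk' ℂ (V := Fin n → ℂ))) : T2Space (ℙ ℂ (Fin n → ℂ)) := by
  rw [t2Space_iff_of_isOpenQuotientMap (isOpenQuotientMap_mk' h)]
  have : {q : {v : Fin n → ℂ // v ≠ 0} × {v : Fin n → ℂ // v ≠ 0} | mk' ℂ q.1 = mk' ℂ q.2} =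
      ⋂ i, ⋂ j, {q | q.1.1 i * q.2.1 j = q.1.1 j * q.2.1 i} := by
    ext q
    simpa using mk_eq_mk_iff_mul q.1.2 q.2.2
  rw [this]
  exact isClosed_iInter fun i => isClosed_iInter fun j => isClosed_eq
    (((continuous_coe_apply i).comp continuous_fst).mul ((continuous_coe_apply j).comp continuous_snd))
    (((continuous_coe_apply j).comp continuous_fst).mul ((continuous_coe_apply i).comp continuous_snd))

theorem Projectivization.compactSpace {n : ℕ} [TopologicalSpace (ℙ ℂ (Fin n → ℂ))]
    (h : IsQuotientMap (mk' ℂ (V := Fin n → ℂ))) : CompactSpace (ℙ ℂ (Fin n → ℂ)) := by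
  let f : Metric.sphere (0 : Fin n → ℂ) 1 → ℙ ℂ (Fin n → ℂ) := fun v =>
    mk' ℂ ⟨v, ne_zero_of_mem_unit_sphere v⟩
  have hf : Continuous f := h.continuous.comp (by fun_prop)
  refine Function.Surjective.compactSpace (f := f) hf fun p => ?_
  induction p using Projectivization.ind with
  | h v hv =>
    have hn : ‖v‖ ≠ 0 := norm_ne_zero_iff.2 hv
    refine ⟨⟨((‖v‖⁻¹ : ℝ) : ℂ) • v, ?_⟩, ?_⟩
    · simp [norm_smul, hn]
    · exact (mk_eq_mk_iff' ℂ _ _ _ _).2 ⟨_, rfl⟩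

theorem isQuotientMap_mk'_four :
    IsQuotientMap (mk' ℂ (V := Fin 4 → ℂ)) := isQuotientMap_quot_mk

instance : T2Space (ℙ ℂ (Fin 4 → ℂ)) := Projectivization.t2Space isQuotientMap_mk'_four

/-- The projective plane `ℙ(ℂ³)` carries the quotient topology from `ℂ³ − {0}`. -/
noncomputable instance : TopologicalSpace (ℙ ℂ (Fin 3 → ℂ)) :=
  inferInstanceAs (TopologicalSpace (Quotient (projectivizationSetoid ℂ (Fin 3 → ℂ))))

theorem isQuotientMap_mk'_three :
    IsQuotientMap (mk' ℂ (V := Fin 3 → ℂ)) := isQuotientMap_quot_mk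

instance : T2Space (ℙ ℂ (Fin 3 → ℂ)) := Projectivization.t2Space isQuotientMap_mk'_three

instance : CompactSpace (ℙ ℂ (Fin 3 → ℂ)) := Projectivization.compactSpace isQuotientMap_mk'_three

theorem Projectivization.rep_mk_eq_smul {n : ℕ} (v : Fin n → ℂ) (hv : v ≠ 0) :
    ∃ a : ℂ, a ≠ 0 ∧ (mk ℂ v hv).rep = a • v := by
  obtain ⟨a, ha⟩ := exists_smul_eq_mk_rep ℂ v hv
  exact ⟨a, a.ne_zero, ha.symm⟩

theorem Projectivization.rep_mk_apply_ne_zero {n : ℕ} (v : Fin n → ℂ) (hv : v ≠ 0) (i : Fin n) :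
    (mk ℂ v hv).rep i ≠ 0 ↔ v i ≠ 0 := by
  obtain ⟨a, ha, h⟩ := rep_mk_eq_smul v hv
  simp [h, ha]

theorem Projectivization.rep_mk_div {n : ℕ} (v : Fin n → ℂ) (hv : v ≠ 0) (i k : Fin n) :
    (mk ℂ v hv).rep k / (mk ℂ v hv).rep i = v k / v i := by
  obtain ⟨a, ha, h⟩ := rep_mk_eq_smul v hv
  simp [h, mul_div_mul_left _ _ ha]

theorem isOpen_rep_apply_ne_zero (i : Fin 3) : IsOpen {p : ℙ ℂ (Fin 3 → ℂ) | p.rep i ≠ 0} := by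
  rw [← isQuotientMap_mk'_three.isOpen_preimage]
  have : mk' ℂ ⁻¹' {p : ℙ ℂ (Fin 3 → ℂ) | p.rep i ≠ 0} = {v | v.1 i ≠ 0} := by
    ext v
    exact rep_mk_apply_ne_zero v.1 v.2 i
  rw [this]
  exact isOpen_ne.preimage (continuous_coe_apply i)

theorem continuousOn_rep_div (i k : Fin 3) :
    ContinuousOn (fun p : ℙ ℂ (Fin 3 → ℂ) => p.rep k / p.rep i) {p | p.rep i ≠ 0} := by
  rw [isQuotientMap_mk'_three.continuousOn_isOpen_iff (isOpen_rep_apply_ne_zero i)]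
  refine ContinuousOn.congr (f := fun v : {v : Fin 3 → ℂ // v ≠ 0} => v.1 k / v.1 i) ?_ fun v _ => rep_mk_div v.1 v.2 i k
  exact (continuous_coe_apply k).continuousOn.div (continuous_coe_apply i).continuousOn
    fun v hv => (rep_mk_apply_ne_zero v.1 v.2 i).1 hv

end ProjectiveSpace

/-- The condition `x₀y₀ = x₁y₁ = x₂y₂` on two vectors of `ℂ³`, which cuts out the del Pezzo surface
of degree six in `ℙ² × ℙ²`. -/
def Incident (x y : Fin 3 → ℂ) : Prop := x 1 * y 1 = x 0 * y 0 ∧ x 2 * y 2 = x 0 * y 0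

/-- The symmetric bilinear map that sends the del Pezzo surface `x₀y₀ = x₁y₁ = x₂y₂` to the Cayley
cubic. -/
def symVec (x y : Fin 3 → ℂ) : Fin 4 → ℂ :=
  ![2 * (x 0 * y 0) - (x 1 * y 2 + x 2 * y 1) - (x 0 * y 2 + x 2 * y 0) - (x 0 * y 1 + x 1 * y 0),
    2 * (x 0 * y 0) - (x 1 * y 2 + x 2 * y 1) + (x 0 * y 2 + x 2 * y 0) + (x 0 * y 1 + x 1 * y 0),
    2 * (x 0 * y 0) + (x 1 * y 2 + x 2 * y 1) - (x 0 * y 2 + x 2 * y 0) + (x 0 * y 1 + x 1 * y 0),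
    2 * (x 0 * y 0) + (x 1 * y 2 + x 2 * y 1) + (x 0 * y 2 + x 2 * y 0) - (x 0 * y 1 + x 1 * y 0)]

theorem Incident.symm {x y : Fin 3 → ℂ} (h : Incident x y) : Incident y x :=
  ⟨by linear_combination h.1, by linear_combination h.2⟩

theorem incident_smul_iff {a b : ℂ} (ha : a ≠ 0) (hb : b ≠ 0) (x y : Fin 3 → ℂ) :
    Incident (a • x) (b • y) ↔ Incident x y := by
  have h : ∀ s t : ℂ, a * s * (b * t) = a * b * (s * t) := fun s t => by ring
  simp [Incident, h, ha, hb]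

theorem symVec_comm (x y : Fin 3 → ℂ) : symVec x y = symVec y x := by
  ext i
  fin_cases i <;> simp [symVec] <;> ring

theorem symVec_smul (a b : ℂ) (x y : Fin 3 → ℂ) :
    symVec (a • x) (b • y) = (a * b) • symVec x y := by
  ext i
  fin_cases i <;> simp [symVec] <;> ring

/-- On the del Pezzo surface, `symVec x y` determines the product of the linear forms with
coefficients `x` and `y`. -/
theorem dotProduct_mul_dotProduct_of_symVec_eq {x y x' y' : Fin 3 → ℂ} {c : ℂ}
    (h : Incident x y) (h' : Incident x' y') (hs : symVec x' y' = c • symVec x y)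
    (T : Fin 3 → ℂ) : (x' ⬝ᵥ T) * (y' ⬝ᵥ T) = c * ((x ⬝ᵥ T) * (y ⬝ᵥ T)) := by
  have e0 := congrFun hs 0
  have e1 := congrFun hs 1
  have e2 := congrFun hs 2
  have e3 := congrFun hs 3
  simp only [symVec, Pi.smul_apply, smul_eq_mul, Matrix.cons_val] at e0 e1 e2 e3
  simp only [dotProduct, Fin.sum_univ_three]
  linear_combination (T 1 ^ 2) * (h'.1 - c * h.1) + (T 2 ^ 2) * (h'.2 - c * h.2) +
    (T 0 ^ 2 + T 1 ^ 2 + T 2 ^ 2) * (e0 + e1 + e2 + e3) / 8 +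
    (T 1 * T 2) * (e2 + e3 - e0 - e1) / 4 + (T 0 * T 2) * (e1 + e3 - e0 - e2) / 4 +
    (T 0 * T 1) * (e1 + e2 - e0 - e3) / 4

/-- If the product of two linear forms vanishes on the kernel of a third one, then one of the
two is a multiple of the third. -/
theorem Module.Dual.exists_eq_smul_of_mul_eq_zero {V : Type*} [AddCommGroup V] [Module ℂ V]
    (f g h : V →ₗ[ℂ] ℂ) (H : ∀ v, h v = 0 → f v * g v = 0) :
    (∃ c : ℂ, f = c • h) ∨ ∃ c : ℂ, g = c • h := by
  have key : ∀ f' : V →ₗ[ℂ] ℂ, (∀ v, h v = 0 → f' v = 0) → ∃ c : ℂ, f' = c • h := by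
    intro f' hf'
    have := mem_span_of_iInf_ker_le_ker (L := fun _ : Unit => h) (K := f')
      (by rw [iInf_const]; exact fun v hv => hf' v hv)
    obtain ⟨c, hc⟩ := Submodule.mem_span_singleton.1 (by simpa using this)
    exact ⟨c, hc.symm⟩
  by_contra! hne
  obtain ⟨v, hv, hfv⟩ : ∃ v, h v = 0 ∧ f v ≠ 0 := by
    by_contra! hcon
    obtain ⟨c, hc⟩ := key f hcon
    exact hne.1 c hc
  obtain ⟨w, hw, hgw⟩ : ∃ w, h w = 0 ∧ g w ≠ 0 := by
    by_contra! hcon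
    obtain ⟨c, hc⟩ := key g hcon
    exact hne.2 c hc
  have hgv : g v = 0 := (mul_eq_zero.1 (H v hv)).resolve_left hfv
  have hfw : f w = 0 := (mul_eq_zero.1 (H w hw)).resolve_right hgw
  have := H (v + w) (by simp [hv, hw])
  simp [hgv, hfw, hfv, hgw] at this

theorem exists_eq_smul_of_dotProduct_mul_eq_zero {x y z : Fin 3 → ℂ}
    (H : ∀ T, z ⬝ᵥ T = 0 → (x ⬝ᵥ T) * (y ⬝ᵥ T) = 0) :
    (∃ c : ℂ, x = c • z) ∨ ∃ c : ℂ, y = c • z := by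
  have hinj : ∀ {v w : Fin 3 → ℂ} {c : ℂ},
      dotProductBilin ℂ ℂ v = c • dotProductBilin ℂ ℂ w → v = c • w := by
    intro v w c h
    refine dotProduct_eq _ _ fun T => ?_
    simpa using LinearMap.congr_fun h T
  rcases Module.Dual.exists_eq_smul_of_mul_eq_zero (dotProductBilin ℂ ℂ x) (dotProductBilin ℂ ℂ y)
    (dotProductBilin ℂ ℂ z) H with ⟨c, hc⟩ | ⟨c, hc⟩
  · exact Or.inl ⟨c, hinj hc⟩
  · exact Or.inr ⟨c, hinj hc⟩

theorem exists_eq_smul_of_dotProduct_mul_eq {x y x' y' : Fin 3 → ℂ} {c : ℂ} (hx' : x' ≠ 0)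
    (hy' : y' ≠ 0) (hc : c ≠ 0)
    (H : ∀ T, (x' ⬝ᵥ T) * (y' ⬝ᵥ T) = c * ((x ⬝ᵥ T) * (y ⬝ᵥ T))) :
    (∃ a b : ℂ, x = a • x' ∧ y = b • y') ∨ ∃ a b : ℂ, x = a • y' ∧ y = b • x' := by
  have aux : ∀ {v w : Fin 3 → ℂ} {a : ℂ}, v = a • x' →
      (∀ T, (x' ⬝ᵥ T) * (y' ⬝ᵥ T) = c * ((v ⬝ᵥ T) * (w ⬝ᵥ T))) → ∃ b : ℂ, w = b • y' := by
    rintro v w a rfl h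
    have h0 : ∀ T, (0 : Fin 3 → ℂ) ⬝ᵥ T = 0 → (x' ⬝ᵥ T) * ((y' - (c * a) • w) ⬝ᵥ T) = 0 := by
      intro T _
      have := h T
      rw [smul_dotProduct, smul_eq_mul] at this
      rw [sub_dotProduct, smul_dotProduct, smul_eq_mul]
      linear_combination this
    rcases exists_eq_smul_of_dotProduct_mul_eq_zero h0 with ⟨d, hd⟩ | ⟨d, hd⟩
    · exact absurd (by simpa using hd) hx'
    · have hy : y' = (c * a) • w := sub_eq_zero.1 (by simpa using hd)
      have hca : c * a ≠ 0 := fun h => hy' (by simpa [h] using hy)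
      exact ⟨(c * a)⁻¹, by rw [hy, smul_smul, inv_mul_cancel₀ hca, one_smul]⟩
  have h0 : ∀ T, x' ⬝ᵥ T = 0 → (x ⬝ᵥ T) * (y ⬝ᵥ T) = 0 := fun T hT => by
    have := H T
    rw [hT, zero_mul] at this
    exact (mul_eq_zero.1 this.symm).resolve_left hc
  rcases exists_eq_smul_of_dotProduct_mul_eq_zero h0 with ⟨a, ha⟩ | ⟨a, ha⟩
  · obtain ⟨b, hb⟩ := aux ha H
    exact Or.inl ⟨a, b, ha, hb⟩
  · obtain ⟨b, hb⟩ := aux (w := x) ha fun T => by rw [H T]; ring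
    exact Or.inr ⟨b, a, hb, ha⟩

theorem symVec_ne_zero {x y : Fin 3 → ℂ} (hx : x ≠ 0) (hy : y ≠ 0) (h : Incident x y) :
    symVec x y ≠ 0 := by
  intro hs
  have H := dotProduct_mul_dotProduct_of_symVec_eq (c := 0) h h (by rw [hs, smul_zero])
  rcases exists_eq_smul_of_dotProduct_mul_eq_zero (z := 0) fun T _ => by simpa using H T with
    ⟨a, ha⟩ | ⟨a, ha⟩
  · exact hx (by simpa using ha)
  · exact hy (by simpa using ha)

theorem eval_cayleyF (v : Fin 4 → ℂ) : eval v cayleyF =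
    4 * (v 0 ^ 3 + v 1 ^ 3 + v 2 ^ 3 + v 3 ^ 3) - (v 0 + v 1 + v 2 + v 3) ^ 3 := by
  simp [cayleyF, Fin.sum_univ_four]

theorem mk_mem_cayleyCubic {v : Fin 4 → ℂ} (hv : v ≠ 0) :
    Projectivization.mk ℂ v hv ∈ cayleyCubic ↔ eval v cayleyF = 0 := by
  refine ⟨fun h => h v hv rfl, fun h w hw hwv => ?_⟩
  obtain ⟨a, rfl⟩ := (Projectivization.mk_eq_mk_iff' ℂ _ _ _ _).1 hwv
  rw [eval_cayleyF] at h ⊢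
  simp only [Pi.smul_apply, smul_eq_mul]
  linear_combination a ^ 3 * h

theorem eval_symVec {x y : Fin 3 → ℂ} (h : Incident x y) : eval (symVec x y) cayleyF = 0 := by
  obtain ⟨h1, h2⟩ := h
  have key : 4 * (x 0 * y 0) * (x 1 * y 1) * (x 2 * y 2) +
      (x 1 * y 2 + x 2 * y 1) * (x 0 * y 2 + x 2 * y 0) * (x 0 * y 1 + x 1 * y 0) -
      (x 0 * y 0) * (x 1 * y 2 + x 2 * y 1) ^ 2 - (x 1 * y 1) * (x 0 * y 2 + x 2 * y 0) ^ 2 -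
      (x 2 * y 2) * (x 0 * y 1 + x 1 * y 0) ^ 2 = 0 := by ring
  rw [h1, h2] at key
  rw [eval_cayleyF]
  simp only [symVec, Matrix.cons_val]
  linear_combination (-96) * key

theorem exists_mul_eq_one_add_eq (c : ℂ) : ∃ u u' : ℂ, u * u' = 1 ∧ u + u' = c := by
  obtain ⟨s, hs⟩ := IsAlgClosed.exists_pow_nat_eq (c ^ 2 - 4) two_pos
  exact ⟨(c + s) / 2, (c - s) / 2, by linear_combination -hs / 4, by ring⟩

/-- A symmetric `3 × 3` matrix with constant diagonal and zero determinant is a symmetrized product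
of two vectors. -/
theorem exists_incident_of_relation {m a b c : ℂ}
    (h : 4 * m ^ 3 + a * b * c - m * (a ^ 2 + b ^ 2 + c ^ 2) = 0)
    (hne : ¬(m = 0 ∧ a = 0 ∧ b = 0 ∧ c = 0)) :
    ∃ x y : Fin 3 → ℂ, x ≠ 0 ∧ y ≠ 0 ∧ Incident x y ∧ x 0 * y 0 = m ∧
      x 1 * y 2 + x 2 * y 1 = a ∧ x 0 * y 2 + x 2 * y 0 = b ∧ x 0 * y 1 + x 1 * y 0 = c := by
  by_cases hm : m = 0
  · subst hm
    have h0 : a * b * c = 0 := by linear_combination h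
    rcases mul_eq_zero.1 h0 with hab | rfl
    · rcases mul_eq_zero.1 hab with rfl | rfl
      · exact ⟨![1, 0, 0], ![0, c, b], by simp, fun H => hne (by simp_all), by simp [Incident]⟩
      · exact ⟨![0, 1, 0], ![c, 0, a], by simp, fun H => hne (by simp_all), by simp [Incident]⟩
    · exact ⟨![0, 0, 1], ![b, a, 0], by simp, fun H => hne (by simp_all), by simp [Incident]⟩
  · obtain ⟨u, u', hu, hc⟩ := exists_mul_eq_one_add_eq (c / m)
    obtain ⟨v, v', hv, hb⟩ := exists_mul_eq_one_add_eq (b / m)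
    rw [eq_div_iff hm] at hc hb
    subst hc hb
    have key : (u * v' + v * u') * m = a ∨ (u * v + v' * u') * m = a := by
      have : m * (((u * v' + v * u') * m - a) * ((u * v + v' * u') * m - a)) = 0 := by
        linear_combination (-h) + m ^ 3 * (v ^ 2 + v' ^ 2 - 2) * hu + m ^ 3 * (u ^ 2 + u' ^ 2 - 2) * hv
      rcases mul_eq_zero.1 ((mul_eq_zero.1 this).resolve_left hm) with h | h
      · exact Or.inl (sub_eq_zero.1 h)
      · exact Or.inr (sub_eq_zero.1 h)
    rcases key with rfl | rfl
    · refine ⟨![1, u, v], ![m, m * u', m * v'], by simp, by simp [hm], ⟨?_, ?_⟩, ?_, ?_, ?_, ?_⟩ <;>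
        simp only [Matrix.cons_val]
      · linear_combination m * hu
      · linear_combination m * hv
      all_goals ring
    · refine ⟨![1, u, v'], ![m, m * u', m * v], by simp, by simp [hm], ⟨?_, ?_⟩, ?_, ?_, ?_, ?_⟩ <;>
        simp only [Matrix.cons_val]
      · linear_combination m * hu
      · linear_combination m * hv
      all_goals ring

/-- Every vector on the affine cone over the Cayley cubic is of the form `symVec x y`. -/
theorem exists_symVec_eq {v : Fin 4 → ℂ} (hv : v ≠ 0) (h : eval v cayleyF = 0) :
    ∃ x y : Fin 3 → ℂ, x ≠ 0 ∧ y ≠ 0 ∧ Incident x y ∧ symVec x y = v := by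
  rw [eval_cayleyF] at h
  obtain ⟨x, y, hx, hy, hxy, hm, ha, hb, hc⟩ := exists_incident_of_relation
    (m := (v 0 + v 1 + v 2 + v 3) / 8) (a := (-v 0 - v 1 + v 2 + v 3) / 4)
    (b := (-v 0 + v 1 - v 2 + v 3) / 4) (c := (-v 0 + v 1 + v 2 - v 3) / 4)
    (by linear_combination (-1 / 96) * h) fun ⟨hm, ha, hb, hc⟩ => hv <| by
      ext i
      fin_cases i
      · change v 0 = 0
        linear_combination 2 * hm - ha - hb - hc
      · change v 1 = 0
        linear_combination 2 * hm - ha + hb + hc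
      · change v 2 = 0
        linear_combination 2 * hm + ha - hb + hc
      · change v 3 = 0
        linear_combination 2 * hm + ha + hb - hc
  refine ⟨x, y, hx, hy, hxy, ?_⟩
  ext i
  fin_cases i <;> simp [symVec, hm, ha, hb, hc] <;> ring

/-- The vector with entry `-1` at position `k` and all other entries equal to `1`. -/
def nodeVec (k : Fin 4) : Fin 4 → ℂ := fun i => if i = k then -1 else 1

theorem nodeVec_ne_zero (k : Fin 4) : nodeVec k ≠ 0 := fun h => by
  have := congrFun h k
  simp [nodeVec] at this

theorem cayleyW_apply (j : Fin 4) : cayleyW j = if j = 3 then -1 else 1 := by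
  fin_cases j <;> simp [cayleyW]

theorem mem_cayleySing_iff {p : ℙ ℂ (Fin 4 → ℂ)} :
    p ∈ cayleySing ↔ ∃ k, p = Projectivization.mk ℂ (nodeVec k) (nodeVec_ne_zero k) := by
  have key : ∀ σ : Equiv.Perm (Fin 4), (fun i => cayleyW (σ i)) = nodeVec (σ.symm 3) := by
    intro σ
    ext i
    rw [cayleyW_apply, nodeVec]
    simp only [Equiv.eq_symm_apply]
  constructor
  · rintro ⟨σ, rfl⟩
    exact ⟨σ.symm 3, by simp only [key]⟩
  · rintro ⟨k, rfl⟩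
    exact ⟨Equiv.swap k 3, by simp only [key, Equiv.symm_swap, Equiv.swap_apply_right]⟩

/-- The coordinates of the vectors whose images under `v ↦ symVec v v` are the four nodes. -/
def nodeRoot : Fin 4 → Fin 3 → ℂ := ![![1, 1, 1], ![1, -1, -1], ![-1, 1, -1], ![-1, -1, 1]]

theorem nodeRoot_ne_zero (k : Fin 4) : nodeRoot k ≠ 0 := by
  fin_cases k <;> simp [nodeRoot]

theorem incident_nodeRoot (k : Fin 4) : Incident (nodeRoot k) (nodeRoot k) := by
  fin_cases k <;> simp [nodeRoot, Incident]

theorem symVec_nodeRoot (k : Fin 4) :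
    symVec (nodeRoot k) (nodeRoot k) = (4 : ℂ) • nodeVec k := by
  ext i
  fin_cases k <;> fin_cases i <;> simp [nodeRoot, nodeVec, symVec] <;> norm_num

theorem exists_eq_smul_nodeRoot {x : Fin 3 → ℂ} (h : Incident x x) :
    ∃ k, ∃ a : ℂ, x = a • nodeRoot k := by
  have h1 : x 1 ^ 2 = x 0 ^ 2 := by linear_combination h.1
  have h2 : x 2 ^ 2 = x 0 ^ 2 := by linear_combination h.2
  rcases sq_eq_sq_iff_eq_or_eq_neg.1 h1 with h1 | h1 <;>
    rcases sq_eq_sq_iff_eq_or_eq_neg.1 h2 with h2 | h2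
  · refine ⟨0, x 0, ?_⟩
    ext i
    fin_cases i <;> simp [nodeRoot, h1, h2]
  · refine ⟨3, -x 0, ?_⟩
    ext i
    fin_cases i <;> simp [nodeRoot, h1, h2]
  · refine ⟨2, -x 0, ?_⟩
    ext i
    fin_cases i <;> simp [nodeRoot, h1, h2]
  · refine ⟨1, x 0, ?_⟩
    ext i
    fin_cases i <;> simp [nodeRoot, h1, h2]

section DelPezzo

open Projectivization Topology

/-- The action of `ℤ/2ℤ` on a type through an involution. -/
abbrev involutionAction {E : Type*} (τ : E → E) (hτ : Function.Involutive τ) :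
    AddAction (ZMod 2) E where
  vadd g e := if g = 0 then e else τ e
  zero_vadd e := if_pos rfl
  add_vadd g h e := by
    change (if g + h = 0 then e else τ e) = if g = 0 then (if h = 0 then e else τ e)
      else τ (if h = 0 then e else τ e)
    have hcases : ∀ g : ZMod 2, g = 0 ∨ g = 1 := by decide
    rcases hcases g with rfl | rfl <;> rcases hcases h with rfl | rfl <;>
      simp [hτ e, CharTwo.add_self_eq_zero]

/-- The quotient of a simply connected Hausdorff space by a free involution has fundamental group
`ℤ/2ℤ`. -/
theorem nonempty_fundamentalGroup_mulEquiv_of_involution {E X : Type*} [TopologicalSpace E]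
    [T2Space E] [SimplyConnectedSpace E] [TopologicalSpace X] {f : E → X} (hf : IsQuotientMap f)
    {τ : E → E} (hc : Continuous τ) (hτ : Function.Involutive τ) (hfix : ∀ e, τ e ≠ e)
    (hfτ : ∀ e₁ e₂, f e₁ = f e₂ ↔ e₁ = e₂ ∨ e₁ = τ e₂) (x : X) :
    Nonempty (FundamentalGroup X x ≃* Multiplicative (ZMod 2)) := by
  let _ := involutionAction τ hτ
  have h0 : ∀ e : E, (0 : ZMod 2) +ᵥ e = e := zero_vadd _
  have h1 : ∀ e : E, (1 : ZMod 2) +ᵥ e = τ e := fun e => if_neg one_ne_zero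
  have hcases : ∀ g : ZMod 2, g = 0 ∨ g = 1 := by decide
  have hcov : IsAddQuotientCoveringMap f (ZMod 2) :=
    { hf with
      continuous_const_vadd := fun g => by
        rcases hcases g with rfl | rfl
        · simpa only [h0] using continuous_id'
        · simpa only [h1] using hc
      apply_eq_iff_mem_orbit := fun {e₁ e₂} => by
        rw [hfτ]
        constructor
        · rintro (h | h)
          · exact ⟨0, (h0 e₂).trans h.symm⟩
          · exact ⟨1, (h1 e₂).trans h.symm⟩
        · rintro ⟨g, h⟩
          rcases hcases g with rfl | rfl
          · exact Or.inl (h.symm.trans (h0 e₂))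
          · exact Or.inr (h.symm.trans (h1 e₂))
      disjoint := fun e => by
        obtain ⟨A, B, hA, hB, heA, heB, hAB⟩ := t2_separation (hfix e)
        refine ⟨τ ⁻¹' A ∩ B, ((hA.preimage hc).inter hB).mem_nhds ⟨heA, heB⟩, fun g hg => ?_⟩
        rcases hcases g with rfl | rfl
        · rfl
        · obtain ⟨_, ⟨y, hy, rfl⟩, hz⟩ := hg
          simp only [h1] at hz
          exact absurd hz.2 (hAB.notMem_of_mem_left hy.1) }
  obtain ⟨e, he⟩ := hf.surjective x
  exact ⟨(hcov.fundamentalGroupEquiv ⟨e, he⟩).trans MulOpposite.opMulEquiv.symm⟩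

/-- The del Pezzo surface of degree six `x₀y₀ = x₁y₁ = x₂y₂` in `ℙ² × ℙ²`. -/
def delPezzo : Set (ℙ ℂ (Fin 3 → ℂ) × ℙ ℂ (Fin 3 → ℂ)) := {p | Incident p.1.rep p.2.rep}

theorem mk_mem_delPezzo {x y : Fin 3 → ℂ} (hx : x ≠ 0) (hy : y ≠ 0) :
    (mk ℂ x hx, mk ℂ y hy) ∈ delPezzo ↔ Incident x y := by
  obtain ⟨a, ha, hxa⟩ := rep_mk_eq_smul x hx
  obtain ⟨b, hb, hyb⟩ := rep_mk_eq_smul y hy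
  change Incident (mk ℂ x hx).rep (mk ℂ y hy).rep ↔ _
  rw [hxa, hyb, incident_smul_iff ha hb]

theorem isOpenQuotientMap_prodMap_mk' :
    IsOpenQuotientMap (Prod.map (mk' ℂ (V := Fin 3 → ℂ)) (mk' ℂ (V := Fin 3 → ℂ))) :=
  (isOpenQuotientMap_mk' isQuotientMap_mk'_three).prodMap
    (isOpenQuotientMap_mk' isQuotientMap_mk'_three)

theorem isClosed_delPezzo : IsClosed delPezzo := by
  rw [← isOpenQuotientMap_prodMap_mk'.isQuotientMap.isClosed_preimage]
  have : Prod.map (mk' ℂ (V := Fin 3 → ℂ)) (mk' ℂ (V := Fin 3 → ℂ)) ⁻¹' delPezzo =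
      {p | p.1.1 1 * p.2.1 1 = p.1.1 0 * p.2.1 0} ∩
        {p | p.1.1 2 * p.2.1 2 = p.1.1 0 * p.2.1 0} := by
    ext p
    exact mk_mem_delPezzo p.1.2 p.2.2
  have hc : ∀ i, Continuous fun p : {v : Fin 3 → ℂ // v ≠ 0} × {v : Fin 3 → ℂ // v ≠ 0} =>
      p.1.1 i * p.2.1 i := fun i =>
    ((continuous_coe_apply i).comp continuous_fst).mul ((continuous_coe_apply i).comp continuous_snd)
  rw [this]
  exact (isClosed_eq (hc 1) (hc 0)).inter (isClosed_eq (hc 2) (hc 0))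

instance : CompactSpace delPezzo := isCompact_iff_compactSpace.1 isClosed_delPezzo.isCompact

/-- The map from the del Pezzo surface of degree six onto the Cayley cubic. -/
noncomputable def toCubic (s : delPezzo) : ℙ ℂ (Fin 4 → ℂ) :=
  mk ℂ (symVec s.1.1.rep s.1.2.rep) (symVec_ne_zero (rep_nonzero _) (rep_nonzero _) s.2)

theorem toCubic_mk {x y : Fin 3 → ℂ} (hx : x ≠ 0) (hy : y ≠ 0) (h : Incident x y) :
    toCubic ⟨(mk ℂ x hx, mk ℂ y hy), (mk_mem_delPezzo hx hy).2 h⟩ =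
      mk ℂ (symVec x y) (symVec_ne_zero hx hy h) := by
  obtain ⟨a, ha, hxa⟩ := rep_mk_eq_smul x hx
  obtain ⟨b, hb, hyb⟩ := rep_mk_eq_smul y hy
  rw [toCubic, mk_eq_mk_iff']
  exact ⟨a * b, by rw [hxa, hyb, symVec_smul]⟩

theorem Continuous.symVec {E : Type*} [TopologicalSpace E] {f g : E → Fin 3 → ℂ}
    (hf : Continuous f) (hg : Continuous g) : Continuous fun x => symVec (f x) (g x) := by
  refine continuous_pi fun i => ?_
  fin_cases i <;> simp [_root_.symVec] <;> fun_prop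

theorem continuous_toCubic : Continuous toCubic := by
  rw [(isOpenQuotientMap_prodMap_mk'.restrictPreimage delPezzo).isQuotientMap.continuous_iff]
  have h : ∀ p : Prod.map (mk' ℂ (V := Fin 3 → ℂ)) (mk' ℂ (V := Fin 3 → ℂ)) ⁻¹' delPezzo,
      Incident p.1.1.1 p.1.2.1 := fun p => (mk_mem_delPezzo p.1.1.2 p.1.2.2).1 p.2
  have hc : Continuous fun p : Prod.map (mk' ℂ (V := Fin 3 → ℂ)) (mk' ℂ (V := Fin 3 → ℂ)) ⁻¹'
      delPezzo => symVec p.1.1.1 p.1.2.1 :=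
    ((continuous_subtype_val.comp continuous_fst).symVec
      (continuous_subtype_val.comp continuous_snd)).comp continuous_subtype_val
  refine (isQuotientMap_mk'_four.continuous.comp (hc.subtype_mk fun p =>
    symVec_ne_zero p.1.1.2 p.1.2.2 (h p))).congr fun p => ?_
  exact (toCubic_mk p.1.1.2 p.1.2.2 (h p)).symm

theorem toCubic_mem_cayleyCubic (s : delPezzo) : toCubic s ∈ cayleyCubic :=
  (mk_mem_cayleyCubic _).2 (eval_symVec s.2)

theorem toCubic_eq_iff {s t : delPezzo} :
    toCubic s = toCubic t ↔ s.1 = t.1 ∨ s.1 = t.1.swap := by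
  obtain ⟨⟨a, b⟩, h⟩ := s
  obtain ⟨⟨a', b'⟩, h'⟩ := t
  induction a using Projectivization.ind with | h x hx
  induction b using Projectivization.ind with | h y hy
  induction a' using Projectivization.ind with | h x' hx'
  induction b' using Projectivization.ind with | h y' hy'
  rw [mk_mem_delPezzo] at h h'
  rw [toCubic_mk hx hy h, toCubic_mk hx' hy' h', Prod.swap_prod_mk, Prod.mk.injEq, Prod.mk.injEq]
  constructor
  · intro heq
    obtain ⟨c, hc⟩ := (mk_eq_mk_iff' ℂ _ _ _ _).1 heq.symm
    have hc0 : c ≠ 0 := by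
      rintro rfl
      exact symVec_ne_zero hx' hy' h' (by rw [← hc, zero_smul])
    simp only [mk_eq_mk_iff']
    rcases exists_eq_smul_of_dotProduct_mul_eq hx' hy' hc0
      (dotProduct_mul_dotProduct_of_symVec_eq h h' hc.symm) with
      ⟨a, b, ha, hb⟩ | ⟨a, b, ha, hb⟩
    · exact Or.inl ⟨⟨a, ha.symm⟩, b, hb.symm⟩
    · exact Or.inr ⟨⟨a, ha.symm⟩, b, hb.symm⟩
  · simp only [mk_eq_mk_iff']
    rintro (⟨⟨a, ha⟩, b, hb⟩ | ⟨⟨a, ha⟩, b, hb⟩)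
    · exact ⟨a * b, by rw [← ha, ← hb, symVec_smul]⟩
    · exact ⟨a * b, by rw [← ha, ← hb, symVec_smul, symVec_comm]⟩

theorem surjOn_toCubic {p : ℙ ℂ (Fin 4 → ℂ)} (hp : p ∈ cayleyCubic) : ∃ s, toCubic s = p := by
  induction p using Projectivization.ind with | h v hv
  obtain ⟨x, y, hx, hy, h, rfl⟩ := exists_symVec_eq hv ((mk_mem_cayleyCubic hv).1 hp)
  exact ⟨_, toCubic_mk hx hy h⟩

theorem toCubic_nodeRoot (k : Fin 4) :
    toCubic ⟨(mk ℂ (nodeRoot k) (nodeRoot_ne_zero k), mk ℂ (nodeRoot k) (nodeRoot_ne_zero k)),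
      (mk_mem_delPezzo _ _).2 (incident_nodeRoot k)⟩ = mk ℂ (nodeVec k) (nodeVec_ne_zero k) := by
  rw [toCubic_mk _ _ (incident_nodeRoot k), mk_eq_mk_iff']
  exact ⟨4, (symVec_nodeRoot k).symm⟩

theorem toCubic_mem_cayleySing {s : delPezzo} : toCubic s ∈ cayleySing ↔ s.1.1 = s.1.2 := by
  rw [mem_cayleySing_iff]
  constructor
  · rintro ⟨k, hk⟩
    rw [← toCubic_nodeRoot, toCubic_eq_iff] at hk
    rcases hk with hk | hk <;> exact (congrArg (fun p => p.1 = p.2) hk).mpr rfl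
  · obtain ⟨⟨a, b⟩, h⟩ := s
    rintro (rfl : a = b)
    induction a using Projectivization.ind with | h x hx
    have hxx := (mk_mem_delPezzo hx hx).1 h
    obtain ⟨k, a, hk⟩ := exists_eq_smul_nodeRoot hxx
    refine ⟨k, ?_⟩
    rw [← toCubic_nodeRoot, toCubic_eq_iff]
    have : mk ℂ x hx = mk ℂ (nodeRoot k) (nodeRoot_ne_zero k) :=
      (mk_eq_mk_iff' ℂ _ _ _ _).2 ⟨a, hk.symm⟩
    exact Or.inl (Prod.ext this this)

/-- The preimage of the smooth locus of the Cayley cubic in the del Pezzo surface of degree six. -/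
abbrev smoothCover : Set delPezzo := toCubic ⁻¹' (cayleyCubic \ cayleySing)

theorem mem_smoothCover {s : delPezzo} : s ∈ smoothCover ↔ s.1.1 ≠ s.1.2 := by
  rw [Set.mem_preimage, Set.mem_sdiff, toCubic_mem_cayleySing]
  exact and_iff_right (toCubic_mem_cayleyCubic s)

theorem isQuotientMap_restrictPreimage_toCubic :
    IsQuotientMap ((cayleyCubic \ cayleySing).restrictPreimage toCubic) := by
  refine (continuous_toCubic.isClosedMap.restrictPreimage _).isQuotientMap
    continuous_toCubic.restrictPreimage ?_
  rintro ⟨p, hp⟩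
  obtain ⟨s, rfl⟩ := surjOn_toCubic hp.1
  exact ⟨⟨s, hp⟩, rfl⟩

/-- The involution exchanging the two factors of `ℙ² × ℙ²`. -/
def swapCover (e : smoothCover) : smoothCover :=
  ⟨⟨e.1.1.swap, e.1.2.symm⟩, mem_smoothCover.2 (mem_smoothCover.1 e.2).symm⟩

theorem continuous_swapCover : Continuous swapCover :=
  ((continuous_swap.comp (continuous_subtype_val.comp continuous_subtype_val)).subtype_mk
    _).subtype_mk _

end DelPezzo

section Charts

open Projectivization Topology

theorem Incident.mul_eq {x y : Fin 3 → ℂ} (h : Incident x y) (i j : Fin 3) :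
    x i * y i = x j * y j := by
  have key : ∀ i, x i * y i = x 0 * y 0 := by
    intro i
    fin_cases i
    exacts [rfl, h.1, h.2]
  rw [key i, key j]

/-- The first factor of the affine chart of the del Pezzo surface attached to a permutation `e`:
the vector with coordinates `1, rs, r` at the positions `e 0, e 1, e 2`. -/
def chartFst (e : Equiv.Perm (Fin 3)) (q : ℂ × ℂ) : Fin 3 → ℂ :=
  fun i => ![1, q.1 * q.2, q.1] (e.symm i)

/-- The second factor of the affine chart of the del Pezzo surface attached to a permutation `e`:
the vector with coordinates `rs, 1, s` at the positions `e 0, e 1, e 2`. -/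
def chartSnd (e : Equiv.Perm (Fin 3)) (q : ℂ × ℂ) : Fin 3 → ℂ :=
  fun i => ![q.1 * q.2, 1, q.2] (e.symm i)

theorem chartFst_ne_zero (e : Equiv.Perm (Fin 3)) (q : ℂ × ℂ) : chartFst e q ≠ 0 := fun h => by
  simpa [chartFst] using congrFun h (e 0)

theorem chartSnd_ne_zero (e : Equiv.Perm (Fin 3)) (q : ℂ × ℂ) : chartSnd e q ≠ 0 := fun h => by
  simpa [chartSnd] using congrFun h (e 1)

theorem incident_chart (e : Equiv.Perm (Fin 3)) (q : ℂ × ℂ) :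
    Incident (chartFst e q) (chartSnd e q) := by
  have h : ∀ i, chartFst e q i * chartSnd e q i = q.1 * q.2 := by
    intro i
    simp only [chartFst, chartSnd]
    generalize e.symm i = k
    fin_cases k <;> simp
  exact ⟨(h 1).trans (h 0).symm, (h 2).trans (h 0).symm⟩

theorem mk_chartFst_eq_mk_chartSnd_iff (e : Equiv.Perm (Fin 3)) (q : ℂ × ℂ) :
    mk ℂ (chartFst e q) (chartFst_ne_zero e q) = mk ℂ (chartSnd e q) (chartSnd_ne_zero e q) ↔
      q ∉ puncturedPlane := by
  have hq : q ∉ puncturedPlane ↔ q.1 ^ 2 = 1 ∧ q.2 ^ 2 = 1 := by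
    simp only [puncturedPlane, Set.mem_union, Set.mem_ofPred_eq, not_or, not_not]
  rw [hq, mk_eq_mk_iff_mul]
  constructor
  · intro h
    have h01 := h (e 0) (e 1)
    have h02 := h (e 0) (e 2)
    have h12 := h (e 1) (e 2)
    simp only [chartFst, chartSnd, Equiv.symm_apply_apply, Matrix.cons_val] at h01 h02 h12
    have h1 : q.1 ≠ 0 := fun h => by simp [h] at h01
    have h2 : q.2 ≠ 0 := fun h => by simp [h] at h01
    exact ⟨mul_right_cancel₀ h2 (by linear_combination -h02),
      mul_right_cancel₀ h1 (by linear_combination h12)⟩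
  · rintro ⟨h1, h2⟩ i j
    have key : ∀ i, chartSnd e q i = q.1 * q.2 * chartFst e q i := by
      intro i
      simp only [chartFst, chartSnd]
      generalize e.symm i = k
      fin_cases k <;> simp only [Fin.zero_eta, Fin.mk_one, Fin.reduceFinMk, Matrix.cons_val]
      · ring
      · linear_combination -h1 * q.2 ^ 2 - h2
      · linear_combination -h1 * q.2
    rw [key, key]
    ring

theorem chartFst_div {x y : Fin 3 → ℂ} (h : Incident x y) (e : Equiv.Perm (Fin 3))
    (hx : x (e 0) ≠ 0) (hy : y (e 1) ≠ 0) :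
    chartFst e (x (e 2) / x (e 0), y (e 2) / y (e 1)) = (x (e 0))⁻¹ • x := by
  ext i
  obtain ⟨k, rfl⟩ := e.surjective i
  have h12 := h.mul_eq (e 1) (e 2)
  simp only [chartFst, Equiv.symm_apply_apply, Pi.smul_apply, smul_eq_mul]
  fin_cases k <;> simp only [Fin.zero_eta, Fin.mk_one, Fin.reduceFinMk, Matrix.cons_val] <;>
    field_simp
  linear_combination -h12

theorem chartSnd_div {x y : Fin 3 → ℂ} (h : Incident x y) (e : Equiv.Perm (Fin 3))
    (hx : x (e 0) ≠ 0) (hy : y (e 1) ≠ 0) :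
    chartSnd e (x (e 2) / x (e 0), y (e 2) / y (e 1)) = (y (e 1))⁻¹ • y := by
  ext i
  obtain ⟨k, rfl⟩ := e.surjective i
  have h02 := h.mul_eq (e 0) (e 2)
  simp only [chartSnd, Equiv.symm_apply_apply, Pi.smul_apply, smul_eq_mul]
  fin_cases k <;> simp only [Fin.zero_eta, Fin.mk_one, Fin.reduceFinMk, Matrix.cons_val] <;>
    field_simp
  linear_combination -h02

/-- The affine chart of the double cover of the smooth locus attached to a permutation. -/
noncomputable def chart (e : Equiv.Perm (Fin 3)) (q : puncturedPlane) : smoothCover :=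
  ⟨⟨(mk ℂ (chartFst e q) (chartFst_ne_zero e q), mk ℂ (chartSnd e q) (chartSnd_ne_zero e q)),
    (mk_mem_delPezzo _ _).2 (incident_chart e q)⟩,
    mem_smoothCover.2 fun h => (mk_chartFst_eq_mk_chartSnd_iff e q).1 h q.2⟩

theorem continuous_chart (e : Equiv.Perm (Fin 3)) : Continuous (chart e) := by
  have h1 : Continuous (chartFst e) := by
    refine continuous_pi fun i => ?_
    simp only [chartFst]
    generalize e.symm i = k
    fin_cases k <;> simp <;> fun_prop
  have h2 : Continuous (chartSnd e) := by
    refine continuous_pi fun i => ?_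
    simp only [chartSnd]
    generalize e.symm i = k
    fin_cases k <;> simp <;> fun_prop
  refine ((Continuous.prodMk ?_ ?_).subtype_mk _).subtype_mk _
  · exact isQuotientMap_mk'_three.continuous.comp
      ((h1.comp continuous_subtype_val).subtype_mk fun q => chartFst_ne_zero e q)
  · exact isQuotientMap_mk'_three.continuous.comp
      ((h2.comp continuous_subtype_val).subtype_mk fun q => chartSnd_ne_zero e q)

/-- The image of the affine chart attached to a permutation. -/
def chartImage (e : Equiv.Perm (Fin 3)) : Set smoothCover :=
  {p | p.1.1.1.rep (e 0) ≠ 0 ∧ p.1.1.2.rep (e 1) ≠ 0}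

theorem isOpen_chartImage (e : Equiv.Perm (Fin 3)) : IsOpen (chartImage e) :=
  have h : Continuous fun p : smoothCover => p.1.1 :=
    continuous_subtype_val.comp continuous_subtype_val
  ((isOpen_rep_apply_ne_zero (e 0)).preimage (continuous_fst.comp h)).inter
    ((isOpen_rep_apply_ne_zero (e 1)).preimage (continuous_snd.comp h))

theorem chart_mem_chartImage {e e' : Equiv.Perm (Fin 3)} {q : puncturedPlane} :
    chart e q ∈ chartImage e' ↔ chartFst e q (e' 0) ≠ 0 ∧ chartSnd e q (e' 1) ≠ 0 :=
  and_congr (rep_mk_apply_ne_zero _ _ _) (rep_mk_apply_ne_zero _ _ _)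

/-- The coordinates of a point in the affine chart attached to a permutation. -/
noncomputable def chartCoord (e : Equiv.Perm (Fin 3)) (p : smoothCover) : ℂ × ℂ :=
  (p.1.1.1.rep (e 2) / p.1.1.1.rep (e 0), p.1.1.2.rep (e 2) / p.1.1.2.rep (e 1))

theorem mk_chartFst_chartCoord {e : Equiv.Perm (Fin 3)} {p : smoothCover} (hp : p ∈ chartImage e) :
    mk ℂ (chartFst e (chartCoord e p)) (chartFst_ne_zero _ _) = p.1.1.1 := by
  conv_rhs => rw [← p.1.1.1.mk_rep]
  exact (mk_eq_mk_iff' ℂ _ _ _ _).2 ⟨_, (chartFst_div p.1.2 e hp.1 hp.2).symm⟩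

theorem mk_chartSnd_chartCoord {e : Equiv.Perm (Fin 3)} {p : smoothCover} (hp : p ∈ chartImage e) :
    mk ℂ (chartSnd e (chartCoord e p)) (chartSnd_ne_zero _ _) = p.1.1.2 := by
  conv_rhs => rw [← p.1.1.2.mk_rep]
  exact (mk_eq_mk_iff' ℂ _ _ _ _).2 ⟨_, (chartSnd_div p.1.2 e hp.1 hp.2).symm⟩

theorem chartCoord_mem {e : Equiv.Perm (Fin 3)} {p : smoothCover} (hp : p ∈ chartImage e) :
    chartCoord e p ∈ puncturedPlane := by
  by_contra h
  rw [← mk_chartFst_eq_mk_chartSnd_iff e, mk_chartFst_chartCoord hp,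
    mk_chartSnd_chartCoord hp] at h
  exact mem_smoothCover.1 p.2 h

theorem chart_chartCoord {e : Equiv.Perm (Fin 3)} {p : smoothCover} (hp : p ∈ chartImage e) :
    chart e ⟨chartCoord e p, chartCoord_mem hp⟩ = p :=
  Subtype.ext (Subtype.ext (Prod.ext (mk_chartFst_chartCoord hp) (mk_chartSnd_chartCoord hp)))

theorem continuousOn_chartCoord (e : Equiv.Perm (Fin 3)) :
    ContinuousOn (chartCoord e) (chartImage e) :=
  have h : Continuous fun p : smoothCover => p.1.1 :=
    continuous_subtype_val.comp continuous_subtype_val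
  ((continuousOn_rep_div (e 0) (e 2)).comp (continuous_fst.comp h).continuousOn
      fun _ hp => hp.1).prodMk
    ((continuousOn_rep_div (e 1) (e 2)).comp (continuous_snd.comp h).continuousOn
      fun _ hp => hp.2)

theorem exists_mem_chartImage (p : smoothCover) : ∃ e, p ∈ chartImage e := by
  have hperm : ∀ i j : Fin 3, i ≠ j → ∃ e : Equiv.Perm (Fin 3), e 0 = i ∧ e 1 = j := by decide
  have hother : ∀ i : Fin 3, ∃ j, i ≠ j := by decide
  have hinc : Incident p.1.1.1.rep p.1.1.2.rep := p.1.2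
  by_contra! hcon
  have h0 : ∀ i j, i ≠ j → p.1.1.1.rep i ≠ 0 → p.1.1.2.rep j = 0 := by
    intro i j hij hi
    obtain ⟨e, rfl, rfl⟩ := hperm i j hij
    by_contra hj
    exact hcon e ⟨hi, hj⟩
  obtain ⟨i, hi⟩ := Function.ne_iff.1 p.1.1.1.rep_nonzero
  obtain ⟨k, hk⟩ := Function.ne_iff.1 p.1.1.2.rep_nonzero
  have hik : i = k := by
    by_contra hik
    exact hk (h0 i k hik hi)
  subst hik
  obtain ⟨j, hj⟩ := hother i
  have := hinc.mul_eq i j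
  rw [h0 i j hj hi, mul_zero] at this
  exact (mul_ne_zero hi hk) this

theorem lineDense_chartFst (e : Equiv.Perm (Fin 3)) (i : Fin 3) :
    LineDense {q | chartFst e q i ≠ 0} := by
  simp only [chartFst]
  generalize e.symm i = k
  fin_cases k
  · simpa using LineDense.univ
  · simpa [Set.ofPred_and] using (LineDense.fst_ne 0).inter (LineDense.snd_ne 0)
  · simpa using LineDense.fst_ne 0

theorem lineDense_chartSnd (e : Equiv.Perm (Fin 3)) (i : Fin 3) :
    LineDense {q | chartSnd e q i ≠ 0} := by
  simp only [chartSnd]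
  generalize e.symm i = k
  fin_cases k
  · simpa [Set.ofPred_and] using (LineDense.fst_ne 0).inter (LineDense.snd_ne 0)
  · simpa using LineDense.univ
  · simpa using LineDense.snd_ne 0

theorem joinedIn_chartImage {e e' : Equiv.Perm (Fin 3)} {p p' : smoothCover}
    (hp : p ∈ chartImage e ∩ chartImage e') (hp' : p' ∈ chartImage e ∩ chartImage e') :
    JoinedIn (chartImage e ∩ chartImage e') p p' := by
  have himage : ∀ q, chart e q ∈ chartImage e := fun q =>
    chart_mem_chartImage.2 ⟨by simp [chartFst], by simp [chartSnd]⟩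
  have hmem : ∀ {p} (hp : p ∈ chartImage e ∩ chartImage e'), chartCoord e p ∈
      {q | chartFst e q (e' 0) ≠ 0} ∩ {q | chartSnd e q (e' 1) ≠ 0} := fun hp =>
    chart_mem_chartImage (q := ⟨_, chartCoord_mem hp.1⟩).1 (by rw [chart_chartCoord hp.1]; exact hp.2)
  have := (((lineDense_chartFst e (e' 0)).inter (lineDense_chartSnd e (e' 1))).joinedIn_subtype
    lineDense_puncturedPlane (p := ⟨_, chartCoord_mem hp.1⟩) (q := ⟨_, chartCoord_mem hp'.1⟩)
    (hmem hp) (hmem hp')).map (continuous_chart e)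
  rw [chart_chartCoord hp.1, chart_chartCoord hp'.1] at this
  refine this.mono ?_
  rintro _ ⟨q, hq, rfl⟩
  exact ⟨himage q, chart_mem_chartImage.2 hq⟩

theorem exists_forall_mem_chartImage : ∃ p, ∀ e, p ∈ chartImage e := by
  refine ⟨chart (Equiv.refl _) ⟨(4, 1 / 2), by norm_num [puncturedPlane]⟩, fun e => ?_⟩
  refine chart_mem_chartImage.2 ⟨?_, ?_⟩
  · generalize e 0 = i
    fin_cases i <;> simp [chartFst]
  · generalize e 1 = i
    fin_cases i <;> simp [chartSnd]

theorem homotopic_refl_of_mem_chartImage {e : Equiv.Perm (Fin 3)} {p : smoothCover} (γ : Path p p)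
    (hγ : ∀ t, γ t ∈ chartImage e) : γ.Homotopic (Path.refl p) := by
  let ρ : C(chartImage e, puncturedPlane) := ⟨fun p => ⟨chartCoord e p, chartCoord_mem p.2⟩,
    (continuousOn_chartCoord e).domRestrict.subtype_mk _⟩
  let ψ : C(puncturedPlane, smoothCover) := ⟨chart e, continuous_chart e⟩
  have h : ∀ u : chartImage e, ψ (ρ u) = u := fun u => chart_chartCoord u.2
  exact homotopic_refl_of_factors ρ ψ h γ hγ

instance : SimplyConnectedSpace smoothCover := by
  obtain ⟨x₀, hx₀⟩ := exists_forall_mem_chartImage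
  have hj : ∀ e e', ∀ p ∈ chartImage e ∩ chartImage e',
      JoinedIn (chartImage e ∩ chartImage e') x₀ p :=
    fun e e' p hp => joinedIn_chartImage ⟨hx₀ e, hx₀ e'⟩ hp
  exact simplyConnectedSpace_of_openCover chartImage x₀ isOpen_chartImage exists_mem_chartImage
    hj fun e γ => homotopic_refl_of_mem_chartImage γ

end Charts

theorem involutive_swapCover : Function.Involutive swapCover := fun _ => rfl

theorem swapCover_ne (e : smoothCover) : swapCover e ≠ e := fun h =>
  mem_smoothCover.1 e.2 (congrArg (fun x : smoothCover => x.1.1.2) h)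

theorem restrictPreimage_toCubic_eq_iff (e₁ e₂ : smoothCover) :
    (cayleyCubic \ cayleySing).restrictPreimage toCubic e₁ =
      (cayleyCubic \ cayleySing).restrictPreimage toCubic e₂ ↔ e₁ = e₂ ∨ e₁ = swapCover e₂ := by
  rw [Subtype.ext_iff, Set.restrictPreimage_coe, Set.restrictPreimage_coe, toCubic_eq_iff,
    Subtype.ext_iff, Subtype.ext_iff, Subtype.ext_iff, Subtype.ext_iff]
  rfl

/-- The fundamental group of the complement of the four singular points in the Cayley
cubic, based at `[1:−1:0:0]`, is isomorphic to `ℤ/2ℤ`. -/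
theorem stmt_11 :
    Nonempty (FundamentalGroup (↥(cayleyCubic \ cayleySing)) basePoint' ≃*
      Multiplicative (ZMod 2)) :=
  nonempty_fundamentalGroup_mulEquiv_of_involution isQuotientMap_restrictPreimage_toCubic
    continuous_swapCover involutive_swapCover swapCover_ne restrictPreimage_toCubic_eq_iff _
end
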